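/- arXiv:1206.0313 — 11 statements merged into one kernel-verified Lean document; each statement's English description precedes it below -/
import Mathlib

section
/- For any y ∈ ℝⁿ, X ∈ ℝ^{n×p}, and λ ≥ 0, every lasso solution gives the same fitted value: if β⁽¹⁾ and β⁽²⁾ both minimize the lasso criterion (1/2)‖y − Xβ‖₂² + λ‖β‖₁, then Xβ⁽¹⁾ = Xβ⁽²⁾. -/
open Matrix BigOperators Filter MeasureTheory

/-- The lasso criterion: (1/2)‖y − Xβ‖₂² + λ‖β‖₁. -/
noncomputable def lassoObj {n p : ℕ} (y : Fin n → ℝ) (X : Matrix (Fin n) (Fin p) ℝ)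
    (lam : ℝ) (β : Fin p → ℝ) : ℝ :=
  (1 / 2) * ∑ j, (y j - X.mulVec β j) ^ 2 + lam * ∑ i, |β i|

/-- A lasso solution: a minimizer of the lasso criterion. -/
def IsLassoSol {n p : ℕ} (y : Fin n → ℝ) (X : Matrix (Fin n) (Fin p) ℝ)
    (lam : ℝ) (b : Fin p → ℝ) : Prop :=
  ∀ β : Fin p → ℝ, lassoObj y X lam b ≤ lassoObj y X lam β

/-- Inner product of the i-th column of X with the residual y − Xb. -/
noncomputable def corr {n p : ℕ} (y : Fin n → ℝ) (X : Matrix (Fin n) (Fin p) ℝ)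
    (b : Fin p → ℝ) (i : Fin p) : ℝ :=
  ∑ j, X j i * (y j - X.mulVec b j)

open Classical in
/-- The equicorrelation set E = {i : |X_iᵀ(y − Xb)| = λ}, defined from a solution b. -/
noncomputable def equiSet {n p : ℕ} (y : Fin n → ℝ) (X : Matrix (Fin n) (Fin p) ℝ)
    (lam : ℝ) (b : Fin p → ℝ) : Finset (Fin p) :=
  Finset.univ.filter fun i => |corr y X b i| = lam

/-- The submatrix of X with columns indexed by E. -/
def colSub {n p : ℕ} (X : Matrix (Fin n) (Fin p) ℝ) (E : Finset (Fin p)) :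
    Matrix (Fin n) E ℝ :=
  fun j i => X j i

/-- Every lasso solution gives the same fitted value. -/
theorem stmt1 {n p : ℕ} (y : Fin n → ℝ) (X : Matrix (Fin n) (Fin p) ℝ) (lam : ℝ)
    (hlam : 0 ≤ lam) (b₁ b₂ : Fin p → ℝ)
    (h₁ : IsLassoSol y X lam b₁) (h₂ : IsLassoSol y X lam b₂) :
    X.mulVec b₁ = X.mulVec b₂ := by
  have h1 := h₁ (fun i => (b₁ i + b₂ i) / 2)
  have h2 := h₂ (fun i => (b₁ i + b₂ i) / 2)
  have hm : ∀ j, X.mulVec (fun i => (b₁ i + b₂ i) / 2) j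
      = (X.mulVec b₁ j + X.mulVec b₂ j) / 2 := by
    intro j
    simp only [Matrix.mulVec, dotProduct]
    rw [← Finset.sum_add_distrib, Finset.sum_div]
    exact Finset.sum_congr rfl fun i _ => by ring
  have habs : ∑ i, |(b₁ i + b₂ i) / 2| ≤ (∑ i, |b₁ i| + ∑ i, |b₂ i|) / 2 := by
    rw [← Finset.sum_add_distrib, Finset.sum_div]
    refine Finset.sum_le_sum fun i _ => ?_
    rw [abs_div, abs_two]
    linarith [abs_add_le (b₁ i) (b₂ i)]
  have hq : ∑ j, (y j - (X.mulVec b₁ j + X.mulVec b₂ j) / 2) ^ 2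
      = (1 / 2) * ∑ j, (y j - X.mulVec b₁ j) ^ 2 + (1 / 2) * ∑ j, (y j - X.mulVec b₂ j) ^ 2
        - (1 / 4) * ∑ j, (X.mulVec b₁ j - X.mulVec b₂ j) ^ 2 := by
    simp only [Finset.mul_sum]
    rw [← Finset.sum_add_distrib, ← Finset.sum_sub_distrib]
    exact Finset.sum_congr rfl fun i _ => by ring
  simp only [lassoObj, hm, hq] at h1 h2
  have h3 := mul_le_mul_of_nonneg_left habs hlam
  have h0 : ∑ j, (X.mulVec b₁ j - X.mulVec b₂ j) ^ 2 = 0 :=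
    le_antisymm (by linarith) (Finset.sum_nonneg fun j _ => sq_nonneg _)
  rw [Finset.sum_eq_zero_iff_of_nonneg (fun j _ => sq_nonneg _)] at h0
  funext j
  exact sub_eq_zero.mp (pow_eq_zero_iff two_ne_zero |>.mp (h0 j (Finset.mem_univ j)))
end

section
/- For any y ∈ ℝⁿ, X ∈ ℝ^{n×p}, and λ > 0, every lasso solution has the same ℓ₁ norm: if β⁽¹⁾ and β⁽²⁾ both minimize the lasso criterion (1/2)‖y − Xβ‖₂² + λ‖β‖₁, then ‖β⁽¹⁾‖₁ = ‖β⁽²⁾‖₁. -/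
open Matrix BigOperators Filter MeasureTheory

/-- For λ > 0, every lasso solution has the same ℓ₁ norm. -/
theorem stmt2 {n p : ℕ} (y : Fin n → ℝ) (X : Matrix (Fin n) (Fin p) ℝ) (lam : ℝ)
    (hlam : 0 < lam) (b₁ b₂ : Fin p → ℝ)
    (h₁ : IsLassoSol y X lam b₁) (h₂ : IsLassoSol y X lam b₂) :
    ∑ i, |b₁ i| = ∑ i, |b₂ i| := by
  have hm : ∀ j, X.mulVec ((1/2 : ℝ) • (b₁ + b₂)) j
      = (X.mulVec b₁ j + X.mulVec b₂ j) / 2 := by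
    intro j
    rw [Matrix.mulVec_smul, Matrix.mulVec_add]
    simp only [Pi.smul_apply, Pi.add_apply, smul_eq_mul]
    ring
  have hS : ∑ j, (y j - X.mulVec ((1/2 : ℝ) • (b₁ + b₂)) j) ^ 2
      = (1/2) * ∑ j, (y j - X.mulVec b₁ j) ^ 2 + (1/2) * ∑ j, (y j - X.mulVec b₂ j) ^ 2
        - (1/4) * ∑ j, (X.mulVec b₁ j - X.mulVec b₂ j) ^ 2 := by
    rw [Finset.mul_sum, Finset.mul_sum, Finset.mul_sum, ← Finset.sum_add_distrib,
      ← Finset.sum_sub_distrib]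
    refine Finset.sum_congr rfl fun j _ => ?_
    rw [hm j]
    ring
  have hL : ∑ i, |((1/2 : ℝ) • (b₁ + b₂)) i|
      ≤ (1/2) * ∑ i, |b₁ i| + (1/2) * ∑ i, |b₂ i| := by
    rw [Finset.mul_sum, Finset.mul_sum, ← Finset.sum_add_distrib]
    refine Finset.sum_le_sum fun i _ => ?_
    simp only [Pi.smul_apply, Pi.add_apply, smul_eq_mul]
    rw [abs_mul, abs_of_pos (by norm_num : (0 : ℝ) < 1/2)]
    linarith [abs_add_le (b₁ i) (b₂ i)]
  have e₁ := h₁ ((1/2 : ℝ) • (b₁ + b₂))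
  have e₂ := h₁ b₂
  have e₃ := h₂ b₁
  unfold lassoObj at e₁ e₂ e₃
  rw [hS] at e₁
  have hL' := mul_le_mul_of_nonneg_left hL hlam.le
  have hD0 : 0 ≤ ∑ j, (X.mulVec b₁ j - X.mulVec b₂ j) ^ 2 :=
    Finset.sum_nonneg fun j _ => sq_nonneg _
  have hD : ∑ j, (X.mulVec b₁ j - X.mulVec b₂ j) ^ 2 = 0 := by
    linarith
  have hX : ∀ j, X.mulVec b₁ j = X.mulVec b₂ j := by
    intro j
    have := (Finset.sum_eq_zero_iff_of_nonneg (fun j _ => sq_nonneg _)).1 hD j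
      (Finset.mem_univ j)
    exact sub_eq_zero.1 (pow_eq_zero_iff (two_ne_zero)|>.1 this)
  simp only [hX] at e₂ e₃
  exact mul_left_cancel₀ hlam.ne' (by linarith)
end

section
/- Fix y ∈ ℝⁿ, X ∈ ℝ^{n×p}, and λ > 0, and let E and s be the equicorrelation set and signs. If the columns of X indexed by E are linearly independent (equivalently, null(X_E) = {0}, equivalently rank(X_E) = |E|), then the lasso solution is unique and is given by β̂ᵢ = 0 for all i ∉ E and β̂_E = (X_Eᵀ X_E)⁻¹ (X_Eᵀ y − λ s); in particular, this unique solution has at most min{n,p} nonzero components. -/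
open Matrix BigOperators Filter MeasureTheory

lemma lasso_same_fit {n p : ℕ} (y : Fin n → ℝ) (X : Matrix (Fin n) (Fin p) ℝ) (lam : ℝ)
    (hlam : 0 < lam) (a b : Fin p → ℝ) (ha : IsLassoSol y X lam a) (hb : IsLassoSol y X lam b) :
    X.mulVec a = X.mulVec b := by
  have h1 := ha ((1/2 : ℝ) • (a + b))
  have h2 := hb a
  have h3 := ha b
  have hm : ∀ j, X.mulVec ((1/2 : ℝ) • (a + b)) j = (X.mulVec a j + X.mulVec b j) / 2 := by
    intro j
    rw [Matrix.mulVec_smul, Matrix.mulVec_add]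
    simp only [Pi.smul_apply, Pi.add_apply, smul_eq_mul]
    ring
  have hl : ∑ i, |((1/2 : ℝ) • (a + b)) i| ≤ (1/2) * (∑ i, |a i| + ∑ i, |b i|) := by
    rw [← Finset.sum_add_distrib, Finset.mul_sum]
    apply Finset.sum_le_sum
    intro i _
    simp only [Pi.smul_apply, Pi.add_apply, smul_eq_mul]
    rw [abs_mul, abs_of_pos (by norm_num : (0:ℝ) < 1/2)]
    have := abs_add_le (a i) (b i)
    linarith
  have hs : ∑ j, (y j - X.mulVec ((1/2 : ℝ) • (a + b)) j) ^ 2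
      = (1/2) * ∑ j, (y j - X.mulVec a j) ^ 2 + (1/2) * ∑ j, (y j - X.mulVec b j) ^ 2
        - (1/4) * ∑ j, (X.mulVec a j - X.mulVec b j) ^ 2 := by
    simp only [Finset.mul_sum, ← Finset.sum_add_distrib, ← Finset.sum_sub_distrib]
    apply Finset.sum_congr rfl
    intro j _
    rw [hm]
    ring
  have hl2 := mul_le_mul_of_nonneg_left hl hlam.le
  unfold lassoObj at h1 h2 h3
  rw [hs] at h1
  have h0 : ∑ j, (X.mulVec a j - X.mulVec b j) ^ 2 ≤ 0 := by linarith
  have h0' : ∑ j, (X.mulVec a j - X.mulVec b j) ^ 2 = 0 :=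
    le_antisymm h0 (Finset.sum_nonneg fun _ _ => sq_nonneg _)
  rw [Finset.sum_eq_zero_iff_of_nonneg (fun _ _ => sq_nonneg _)] at h0'
  funext j
  have := h0' j (Finset.mem_univ j)
  have := pow_eq_zero_iff (two_ne_zero) |>.1 this
  linarith

lemma lasso_pert {d K r : ℝ} (hr : 0 < r) (hK : 0 ≤ K)
    (h : ∀ t, |t| ≤ r → 0 ≤ t * d + t ^ 2 * K) : d = 0 := by
  by_contra hd
  have hd' : 0 < |d| := abs_pos.2 hd
  obtain ⟨e, he0, he1, he2⟩ : ∃ e : ℝ, 0 < e ∧ e * |d| ≤ r ∧ e * K < 1 := by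
    refine ⟨min (r / |d|) (1 / (K + 1)), by positivity, ?_, ?_⟩
    · rw [← le_div_iff₀ hd']
      exact min_le_left _ _
    · calc _ ≤ 1 / (K + 1) * K := mul_le_mul_of_nonneg_right (min_le_right _ _) hK
        _ < 1 := by
          rw [one_div_mul_eq_div, div_lt_one (by positivity)]
          linarith
  have := h (-(e * d)) (by rw [abs_neg, abs_mul, abs_of_pos he0]; exact he1)
  have hp : 0 < e * d ^ 2 := by positivity
  nlinarith

lemma lasso_kkt {n p : ℕ} (y : Fin n → ℝ) (X : Matrix (Fin n) (Fin p) ℝ) (lam : ℝ)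
    (hlam : 0 < lam) (b : Fin p → ℝ) (hb : IsLassoSol y X lam b) (i : Fin p) (hi : b i ≠ 0) :
    |corr y X b i| = lam := by
  obtain ⟨σ, hσ, hs⟩ : ∃ σ : ℝ, |σ| = 1 ∧ ∀ t, |t| ≤ |b i| → |b i + t| - |b i| = t * σ := by
    rcases lt_or_gt_of_ne hi with h | h
    · refine ⟨-1, by simp, fun t ht => ?_⟩
      rw [abs_of_neg h] at *
      rw [abs_of_nonpos (by linarith [(abs_le.1 ht).2])]
      ring
    · refine ⟨1, by simp, fun t ht => ?_⟩
      rw [abs_of_pos h] at *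
      rw [abs_of_nonneg (by linarith [(abs_le.1 ht).1])]
      ring
  have key : lam * σ - corr y X b i = 0 := by
    apply lasso_pert (abs_pos.2 hi) (K := (1/2) * ∑ j, X j i ^ 2)
      (by have := Finset.sum_nonneg (s := Finset.univ) fun j _ => sq_nonneg (X j i)
          positivity)
    intro t ht
    have h1 := hb (b + Pi.single i t)
    have hl : ∑ k, |(b + Pi.single i t : Fin p → ℝ) k| = ∑ k, |b k| + t * σ := by
      rw [← hs t ht, ← sub_eq_iff_eq_add', ← Finset.sum_sub_distrib]
      rw [Finset.sum_eq_single i]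
      · simp
      · intro k _ hk
        simp [hk]
      · simp
    have hm : ∀ j, X.mulVec (b + Pi.single i t) j = X.mulVec b j + X j i * t := by
      intro j
      rw [Matrix.mulVec_add, Pi.add_apply, Matrix.mulVec_single]
      simp
    have hq : ∑ j, (y j - X.mulVec (b + Pi.single i t) j) ^ 2
        = ∑ j, (y j - X.mulVec b j) ^ 2 - 2 * t * corr y X b i + t ^ 2 * ∑ j, X j i ^ 2 := by
      unfold corr
      simp only [Finset.mul_sum, ← Finset.sum_add_distrib, ← Finset.sum_sub_distrib]
      apply Finset.sum_congr rfl
      intro j _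
      rw [hm]
      ring
    unfold lassoObj at h1
    rw [hl, hq] at h1
    linarith
  have : corr y X b i = lam * σ := by linarith
  rw [this, abs_mul, hσ, abs_of_pos hlam, mul_one]

lemma lasso_main {n p : ℕ} (y : Fin n → ℝ) (X : Matrix (Fin n) (Fin p) ℝ) (lam : ℝ)
    (hlam : 0 < lam) (β₀ : Fin p → ℝ) (hβ₀ : IsLassoSol y X lam β₀)
    (hind : LinearIndependent ℝ
      (fun i : ↥(equiSet y X lam β₀) => (fun j => X j i.1 : Fin n → ℝ))) :
    ∀ b : Fin p → ℝ, IsLassoSol y X lam b →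
      (∀ i ∉ equiSet y X lam β₀, b i = 0) ∧
      (fun i : ↥(equiSet y X lam β₀) => b i.1) =
        (((colSub X (equiSet y X lam β₀))ᵀ * colSub X (equiSet y X lam β₀))⁻¹).mulVec
          ((colSub X (equiSet y X lam β₀))ᵀ.mulVec y -
            lam • (fun i : ↥(equiSet y X lam β₀) => Real.sign (corr y X β₀ i.1))) ∧
      {i : Fin p | b i ≠ 0}.ncard ≤ min n p := by
  intro b hb
  have hfit := lasso_same_fit y X lam hlam b β₀ hb hβ₀
  have hcorr : ∀ i, corr y X b i = corr y X β₀ i := by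
    intro i
    unfold corr
    rw [hfit]
  have hE : ∀ i, i ∈ equiSet y X lam β₀ ↔ |corr y X β₀ i| = lam := by
    intro i
    simp [equiSet]
  have hz : ∀ i ∉ equiSet y X lam β₀, b i = 0 := by
    intro i hi
    by_contra h
    apply hi
    rw [hE, ← hcorr]
    exact lasso_kkt y X lam hlam b hb i h
  generalize equiSet y X lam β₀ = E at *
  refine ⟨hz, ?_, ?_⟩
  · have hinj : Function.Injective (colSub X E).mulVec := by
      rw [Matrix.mulVec_injective_iff]
      exact hind
    have hpd : ((colSub X E)ᵀ * colSub X E).PosDef := by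
      have := Matrix.PosDef.conjTranspose_mul_self (colSub X E) hinj
      rwa [Matrix.conjTranspose_eq_transpose_of_trivial] at this
    have hu : IsUnit ((colSub X E)ᵀ * colSub X E).det := by
      rw [← Matrix.isUnit_iff_isUnit_det]
      exact hpd.isUnit
    have hXb : (colSub X E).mulVec (fun i : E => b i.1) = X.mulVec b := by
      funext j
      simp only [Matrix.mulVec, dotProduct, colSub]
      rw [Finset.sum_coe_sort E (fun i => X j i * b i)]
      apply Finset.sum_subset (Finset.subset_univ _)
      intro i _ hi
      rw [hz i hi, mul_zero]
    have hg : ((colSub X E)ᵀ * colSub X E).mulVec (fun i : E => b i.1) =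
        (colSub X E)ᵀ.mulVec y - lam • (fun i : E => Real.sign (corr y X β₀ i.1)) := by
      rw [← Matrix.mulVec_mulVec, hXb]
      funext i
      have hi := (hE i.1).1 i.2
      have hsg : lam * Real.sign (corr y X β₀ i.1) = corr y X β₀ i.1 := by
        rw [← hi]
        rcases lt_trichotomy (corr y X β₀ i.1) 0 with h | h | h
        · rw [Real.sign_of_neg h, abs_of_neg h]; ring
        · rw [h]; simp
        · rw [Real.sign_of_pos h, abs_of_pos h]; ring
      simp only [Pi.sub_apply, Pi.smul_apply, smul_eq_mul]
      rw [hsg, ← hcorr]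
      simp only [corr, mul_sub, Finset.sum_sub_distrib]
      simp only [Matrix.mulVec, dotProduct, colSub, Matrix.transpose_apply]
      ring
    rw [← hg, Matrix.mulVec_mulVec, Matrix.nonsing_inv_mul _ hu, Matrix.one_mulVec]
  · have hsub : {i : Fin p | b i ≠ 0} ⊆ (E : Set (Fin p)) := by
      intro i hi
      by_contra h
      exact hi (hz i h)
    have h1 : {i : Fin p | b i ≠ 0}.ncard ≤ E.card := by
      rw [← Set.ncard_coe_finset]
      exact Set.ncard_le_ncard hsub (Finset.finite_toSet E)
    have h2 : E.card ≤ n := by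
      have := hind.fintype_card_le_finrank
      simpa using this
    have h3 : E.card ≤ p := by simpa using Finset.card_le_univ E
    exact le_min (h1.trans h2) (h1.trans h3)

/-- If the columns of X indexed by the equicorrelation set E are
linearly independent, then the lasso solution is unique, is given by
β̂_{-E} = 0 and β̂_E = (X_EᵀX_E)⁻¹(X_Eᵀy − λs), and has at most min{n,p}
nonzero components. -/
theorem stmt4 {n p : ℕ} (y : Fin n → ℝ) (X : Matrix (Fin n) (Fin p) ℝ) (lam : ℝ)
    (hlam : 0 < lam) (β₀ : Fin p → ℝ) (hβ₀ : IsLassoSol y X lam β₀)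
    (hind : LinearIndependent ℝ
      (fun i : ↥(equiSet y X lam β₀) => (fun j => X j i.1 : Fin n → ℝ))) :
    (∃! b : Fin p → ℝ, IsLassoSol y X lam b) ∧
    ∀ b : Fin p → ℝ, IsLassoSol y X lam b →
      (∀ i ∉ equiSet y X lam β₀, b i = 0) ∧
      (fun i : ↥(equiSet y X lam β₀) => b i.1) =
        (((colSub X (equiSet y X lam β₀))ᵀ * colSub X (equiSet y X lam β₀))⁻¹).mulVec
          ((colSub X (equiSet y X lam β₀))ᵀ.mulVec y -
            lam • (fun i : ↥(equiSet y X lam β₀) => Real.sign (corr y X β₀ i.1))) ∧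
      {i : Fin p | b i ≠ 0}.ncard ≤ min n p := by
  have hmain := lasso_main y X lam hlam β₀ hβ₀ hind
  refine ⟨⟨β₀, hβ₀, fun b hb => ?_⟩, hmain⟩
  obtain ⟨h1, h2, -⟩ := hmain b hb
  obtain ⟨h3, h4, -⟩ := hmain β₀ hβ₀
  funext i
  by_cases hi : i ∈ equiSet y X lam β₀
  · exact congrFun (h2.trans h4.symm) ⟨i, hi⟩
  · rw [h1 i hi, h3 i hi]
end

section
/- The set of matrices X ∈ ℝ^{n×p} whose columns are not in general position has Lebesgue measure zero in ℝ^{np}. Consequently, if the entries of X are drawn from any probability distribution absolutely continuous with respect to Lebesgue measure on ℝ^{np}, then with probability one the columns of X are in general position. -/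
open Matrix BigOperators Filter MeasureTheory

/-- Columns of X are in general position: for every k < n, any k+1 distinct
signed columns have an affine span containing no other (signed) column of X. -/
def InGeneralPosition {n p : ℕ} (X : Matrix (Fin n) (Fin p) ℝ) : Prop :=
  ∀ k : ℕ, k < n → ∀ I : Finset (Fin p), I.card = k + 1 →
    ∀ σ : Fin p → ℝ, (∀ i, σ i = 1 ∨ σ i = -1) →
      ∀ i ∉ I, ∀ ε : ℝ, ε = 1 ∨ ε = -1 →
        ε • (fun j => X j i : Fin n → ℝ) ∉
          affineSpan ℝ ((fun m => σ m • (fun j => X j m : Fin n → ℝ)) '' (I : Set (Fin p)))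

lemma aux7 {n p k : ℕ} (hk : k < n) (I : Finset (Fin p)) (hI : I.card = k + 1)
    (σ : Fin p → ℝ) (i : Fin p) (hi : i ∉ I) (ε : ℝ) (hε : ε = 1 ∨ ε = -1) :
    volume {A : Fin n → Fin p → ℝ | ε • (fun j => A j i : Fin n → ℝ) ∈
      affineSpan ℝ ((fun m => σ m • (fun j => A j m : Fin n → ℝ)) '' (I : Set (Fin p)))} = 0 := by
  obtain ⟨f⟩ : Nonempty (I ↪ Fin n) := Function.Embedding.nonempty_of_card_le (by simp; omega)
  let L : (Fin n → Fin p → ℝ) →ₗ[ℝ] ℝ :=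
    ∑ l : I, (LinearMap.proj i : (Fin p → ℝ) →ₗ[ℝ] ℝ) ∘ₗ
      (LinearMap.proj (f l) : (Fin n → Fin p → ℝ) →ₗ[ℝ] (Fin p → ℝ))
  have hL : ∀ B, L B = ∑ l : I, B (f l) i := fun B => by simp [L]
  let S : AffineSubspace ℝ (Fin n → Fin p → ℝ) :=
    (AffineSubspace.mk' (1 : ℝ) ⊥).comap L.toAffineMap
  have hS : ∀ B, B ∈ S ↔ ∑ l : I, B (f l) i = 1 := fun B => by
    simp [S, AffineSubspace.mem_comap, AffineSubspace.mem_mk', hL, sub_eq_zero]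
  have hS0 : volume (S : Set (Fin n → Fin p → ℝ)) = 0 := by
    apply Measure.addHaar_affineSubspace
    intro h
    have : (0 : Fin n → Fin p → ℝ) ∈ S := h ▸ AffineSubspace.mem_top ℝ _ _
    rw [hS] at this
    simp at this
  let F : (Fin n → Fin p → ℝ) → (Fin n → Fin p → ℝ) := fun B j m =>
    if m = i then ε * ∑ l : I, B (f l) i * (σ l * B j l) else B j m
  have hF : Differentiable ℝ F := by
    refine differentiable_pi.2 fun j => differentiable_pi.2 fun m => ?_
    by_cases h : m = i <;> simp only [F, h, if_true, if_false] <;> fun_prop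
  refine measure_mono_null ?_
    (addHaar_image_eq_zero_of_differentiableOn_of_addHaar_eq_zero volume
      (f := F) hF.differentiableOn hS0)
  intro A hA
  simp only [Set.mem_ofPred_eq] at hA
  rw [Set.image_eq_range] at hA
  obtain ⟨w, hw, hA⟩ := eq_affineCombination_of_mem_affineSpan_of_fintype
    (ι := I) (p := fun m : I => σ m • (fun j => A j m : Fin n → ℝ)) hA
  rw [Finset.affineCombination_eq_linear_combination _ _ _ hw] at hA
  have hx : ∀ l, Function.extend f w 0 (f l) = w l := fun l => f.injective.extend_apply _ _ _
  refine ⟨fun j m => if m = i then Function.extend f w 0 j else A j m, ?_, ?_⟩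
  · rw [SetLike.mem_coe, hS]
    simpa only [if_true, hx] using hw
  · funext j m
    by_cases h : m = i
    · subst h
      have hne : ∀ l : I, (l : Fin p) ≠ m := fun l h => hi (h ▸ l.2)
      have := congrFun hA j
      simp only [Pi.smul_apply, Finset.sum_apply, smul_eq_mul] at this
      simp only [F, if_true, hx, hne, if_false]
      rw [← this]
      rcases hε with rfl | rfl <;> ring
    · simp [F, h]

/-- The set of matrices whose columns are not in general position
has Lebesgue measure zero; consequently any probability distribution absolutely
continuous w.r.t. Lebesgue measure puts probability one on general position. -/
theorem stmt7 {n p : ℕ} :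
    (volume {A : Fin n → Fin p → ℝ | ¬ InGeneralPosition (Matrix.of A)} = 0) ∧
    ∀ μ : Measure (Fin n → Fin p → ℝ), IsProbabilityMeasure μ → μ ≪ volume →
      μ {A : Fin n → Fin p → ℝ | ¬ InGeneralPosition (Matrix.of A)} = 0 := by
  suffices h : volume {A : Fin n → Fin p → ℝ | ¬ InGeneralPosition (Matrix.of A)} = 0 from
    ⟨h, fun μ _ hμ => hμ h⟩
  have hfin : {σ : Fin p → ℝ | ∀ i, σ i = 1 ∨ σ i = -1}.Finite := by
    have := Set.Finite.pi (ι := Fin p) (t := fun _ => ({1, -1} : Set ℝ)) (fun _ => by simp)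
    refine this.subset fun σ h => ?_
    simpa [Set.mem_pi] using h
  have hfin2 : {ε : ℝ | ε = 1 ∨ ε = -1}.Finite :=
    (Set.toFinite ({1, -1} : Set ℝ)).subset fun ε h => by simpa using h
  change ∀ᵐ A : Fin n → Fin p → ℝ, InGeneralPosition (Matrix.of A)
  unfold InGeneralPosition
  refine ae_all_iff.2 fun k => ae_all_iff.2 fun hk => ae_all_iff.2 fun I => ae_all_iff.2 fun hI => ?_
  refine (ae_ball_iff hfin.countable).2 fun σ _ => ?_
  refine ae_all_iff.2 fun i => ae_all_iff.2 fun hi => ?_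
  refine (ae_ball_iff hfin2.countable).2 fun ε hε => ?_
  have := aux7 hk I hI σ i hi ε hε
  rw [ae_iff]
  simpa using this
end

section
/- Let f : ℝⁿ → ℝ be differentiable and strictly convex. For Lebesgue-almost every X ∈ ℝ^{n×p} (identifying ℝ^{n×p} with ℝ^{np}), the following holds: for every λ > 0, the problem of minimizing f(Xβ) + λ‖β‖₁ over β ∈ ℝ^p has at most one minimizer, and any minimizer has at most min{n,p} nonzero components. -/
open Matrix BigOperators Filter MeasureTheory

def brd {n p k : ℕ} (hk : k ≤ n) (e : Fin (k+1) → Fin p) (s : Fin p → SignType)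
    (A : Fin n → Fin p → ℝ) : Matrix (Fin (k+1)) (Fin (k+1)) ℝ :=
  Matrix.of (Fin.cons (fun j => ((s (e j) : SignType) : ℝ)) (fun i j => A (Fin.castLE hk i) (e j)))

theorem brd_exists {n p k : ℕ} (hk : k ≤ n) (e : Fin (k+1) → Fin p)
    (he : Function.Injective e) (s : Fin p → SignType) (hs : s (e 0) ≠ 0) :
    ∃ B : Fin n → Fin p → ℝ, (brd hk e s B).det ≠ 0 := by
  refine ⟨fun i l => if ∃ j : Fin k, i = Fin.castLE hk j ∧ l = e j.succ then 1 else 0, ?_⟩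
  have hT : (brd hk e s (fun i l => if ∃ j : Fin k, i = Fin.castLE hk j ∧ l = e j.succ then 1 else 0)).IsUpperTriangular := by
    intro i j hij
    refine Fin.cases ?_ (fun i => ?_) i hij
    · intro h; simp at h
    · intro h
      simp only [brd, of_apply, Fin.cons_succ]
      rw [if_neg]
      rintro ⟨j', h1, h2⟩
      have : i = j' := by simpa using h1
      subst this
      have := he h2
      subst this
      simp at h
  rw [Matrix.det_of_isUpperTriangular hT, Fin.prod_univ_succ]
  have : ∀ i : Fin k, brd hk e s (fun i l => if ∃ j : Fin k, i = Fin.castLE hk j ∧ l = e j.succ then 1 else 0) i.succ i.succ = 1 := by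
    intro i
    simp only [brd, of_apply, Fin.cons_succ]
    rw [if_pos ⟨i, rfl, rfl⟩]
  simp only [this]
  simp only [brd, of_apply, Fin.cons_zero, Finset.prod_const_one, mul_one]
  revert hs
  cases s (e 0) <;> simp

theorem brd_line {n p k : ℕ} (hk : k ≤ n) (e : Fin (k+1) → Fin p)
    (s : Fin p → SignType) (A B : Fin n → Fin p → ℝ) (hB : (brd hk e s B).det ≠ 0) :
    {t : ℝ | (brd hk e s (A + t • B)).det = 0}.Finite := by
  let P : Matrix (Fin (k+1)) (Fin (k+1)) (Polynomial ℝ) :=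
    Matrix.of (Fin.cons (fun j => Polynomial.C ((s (e j) : SignType) : ℝ))
      (fun i j => Polynomial.X * Polynomial.C (A (Fin.castLE hk i) (e j)) + Polynomial.C (B (Fin.castLE hk i) (e j))))
  have hP : ∀ u, P.det.eval u = (brd hk e s (u • A + B)).det := by
    intro u
    rw [← Polynomial.coe_evalRingHom, RingHom.map_det]
    congr 1
    ext i j
    refine Fin.cases ?_ (fun i => ?_) i
    · simp [P, brd]
    · simp [P, brd]; ring
  have hP0 : P.det ≠ 0 := by
    intro h
    have := hP 0
    rw [h] at this
    simp at this
    exact hB this.symm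
  have hfin : {u : ℝ | P.det.eval u = 0}.Finite := Polynomial.finite_setOfPred_isRoot hP0
  refine ((hfin.image (fun u => u⁻¹)).insert 0).subset ?_
  intro t ht
  by_cases h0 : t = 0
  · simp [h0]
  right
  refine ⟨t⁻¹, ?_, by simp⟩
  change P.det.eval t⁻¹ = 0
  rw [hP]
  have : brd hk e s (A + t • B) = Matrix.of (fun i j => (Fin.cons 1 (fun _ => t) : Fin (k+1) → ℝ) i * brd hk e s (t⁻¹ • A + B) i j) := by
    ext i j
    refine Fin.cases ?_ (fun i => ?_) i
    · simp [brd]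
    · simp [brd]; field_simp
  have ht' : (brd hk e s (A + t • B)).det = 0 := ht
  rw [this, Matrix.det_mul_column] at ht'
  rw [mul_eq_zero, Fin.prod_univ_succ] at ht'
  simpa [h0] using ht'

theorem brd_ae {n p k : ℕ} (hk : k ≤ n) (e : Fin (k+1) → Fin p)
    (he : Function.Injective e) (s : Fin p → SignType) (hs : s (e 0) ≠ 0) :
    ∀ᵐ A ∂(volume : Measure (Fin n → Fin p → ℝ)), (brd hk e s A).det ≠ 0 := by
  obtain ⟨B, hB⟩ := brd_exists hk e he s hs
  have hc : Continuous (fun A : Fin n → Fin p → ℝ => (brd hk e s A).det) := by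
    apply Continuous.matrix_det
    apply continuous_matrix
    intro i j
    refine Fin.cases ?_ (fun i => ?_) i
    · simp only [brd, of_apply, Fin.cons_zero]; fun_prop
    · simp only [brd, of_apply, Fin.cons_succ]; fun_prop
  have hm : MeasurableSet {A : Fin n → Fin p → ℝ | (brd hk e s A).det ≠ 0} :=
    (isOpen_ne_fun hc continuous_const).measurableSet
  refine ae_mem_of_ae_add_linearMap_mem (LinearMap.toSpanSingleton ℝ _ B) (volume : Measure ℝ) volume hm ?_
  intro A
  rw [ae_iff]
  have := (brd_line hk e s A B hB).measure_zero volume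
  convert this using 2
  ext t
  exact not_not

theorem ker_zero {n p : ℕ} (A : Fin n → Fin p → ℝ)
    (hA : ∀ k : ℕ, ∀ hk : k ≤ n, ∀ e : Fin (k+1) → Fin p, Function.Injective e →
      ∀ s : Fin p → SignType, s (e 0) ≠ 0 → (brd hk e s A).det ≠ 0)
    (g : (Fin n → ℝ) →L[ℝ] ℝ) (lam : ℝ) (hl : 0 < lam) (s : Fin p → SignType)
    (T : Finset (Fin p)) (hs : ∀ i ∈ T, s i ≠ 0)
    (hg : ∀ i ∈ T, g (fun j => A j i) = -lam * ((s i : SignType) : ℝ))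
    (hT : T.card ≤ n + 1) (c : Fin p → ℝ) (hc : ∀ i ∉ T, c i = 0)
    (h0 : (Matrix.of A).mulVec c = 0) : c = 0 := by
  rcases hk : T.card with _ | k
  · rw [Finset.card_eq_zero] at hk
    ext i; exact hc i (by simp [hk])
  let e := T.orderEmbOfFin hk
  have hsum : ∀ F : Fin p → ℝ, ∑ j, F (e j) * c (e j) = ∑ i, F i * c i := by
    intro F
    have h1 : ∑ i, F i * c i = ∑ i ∈ T, F i * c i := by
      symm
      apply Finset.sum_subset (Finset.subset_univ _)
      intro i _ hi; simp [hc i hi]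
    rw [h1]
    have h2 : T = Finset.univ.map e.toEmbedding := by
      ext i
      have := Set.ext_iff.1 (Finset.range_orderEmbOfFin T hk) i
      simp only [Finset.mem_map, Finset.mem_univ, true_and]
      exact this.symm
    conv_rhs => rw [h2]
    rw [Finset.sum_map]; rfl
  have hker : (brd (by omega : k ≤ n) e s A).mulVec (fun j => c (e j)) = 0 := by
    ext i
    refine Fin.cases ?_ (fun i => ?_) i
    · simp only [mulVec, dotProduct, brd, of_apply, Fin.cons_zero, Pi.zero_apply]
      rw [hsum (fun i => ((s i : SignType) : ℝ))]
      have h3 : (Matrix.of A).mulVec c = ∑ i, c i • (fun j => A j i) := by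
        ext j; simp [mulVec, dotProduct, mul_comm]
      have h4 : g ((Matrix.of A).mulVec c) = 0 := by rw [h0]; simp
      rw [h3, map_sum] at h4
      have h5 : ∑ i, g (c i • (fun j => A j i)) = ∑ i, -lam * (((s i : SignType) : ℝ) * c i) := by
        apply Finset.sum_congr rfl
        intro i _
        by_cases hi : i ∈ T
        · rw [map_smul, hg i hi]; simp; ring
        · simp [hc i hi]
      rw [h5, ← Finset.mul_sum] at h4
      rcases mul_eq_zero.1 h4 with h | h
      · linarith
      · exact h
    · simp only [mulVec, dotProduct, brd, of_apply, Fin.cons_succ, Pi.zero_apply]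
      rw [hsum (fun l => A _ l)]
      exact congrFun h0 _
  have hz := Matrix.eq_zero_of_mulVec_eq_zero
    (hA k (by omega) e e.injective s (hs _ (Finset.orderEmbOfFin_mem T hk 0))) hker
  ext i
  by_cases hi : i ∈ T
  · have : i ∈ Set.range e := by rw [Finset.range_orderEmbOfFin]; exact hi
    obtain ⟨j, rfl⟩ := this
    exact congrFun hz j
  · exact hc i hi

theorem kkt {n p : ℕ} (f : (Fin n → ℝ) → ℝ) (hdiff : Differentiable ℝ f)
    (A : Fin n → Fin p → ℝ) (lam : ℝ) (b : Fin p → ℝ)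
    (hb : ∀ β : Fin p → ℝ,
            f ((Matrix.of A).mulVec b) + lam * ∑ i, |b i| ≤
              f ((Matrix.of A).mulVec β) + lam * ∑ i, |β i|) (i : Fin p) (hi : b i ≠ 0) :
    fderiv ℝ f ((Matrix.of A).mulVec b) (fun j => A j i) = -lam * ((SignType.sign (b i) : SignType) : ℝ) := by
  have h1 : HasDerivAt (fun t : ℝ => f ((Matrix.of A).mulVec b + t • (fun j => A j i)))
      (fderiv ℝ f ((Matrix.of A).mulVec b) (fun j => A j i)) 0 := by
    have hl : HasDerivAt (fun t : ℝ => (Matrix.of A).mulVec b + t • (fun j => A j i)) (fun j => A j i) 0 := by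
      have := ((hasDerivAt_id (0:ℝ)).smul_const (fun j => A j i)).const_add ((Matrix.of A).mulVec b)
      simpa using this
    have hf := (hdiff ((Matrix.of A).mulVec b)).hasFDerivAt
    refine HasFDerivAt.comp_hasDerivAt (0:ℝ) (?_) hl
    simpa using hf
  have h2 : HasDerivAt (fun t : ℝ => |b i + t|) ((SignType.sign (b i) : SignType) : ℝ) 0 := by
    have := (hasDerivAt_abs (x := b i + 0) (by simpa using hi)).comp_const_add (b i) 0
    simpa using this
  have h3 := h1.add (h2.const_mul lam)
  have hmin : IsLocalMin ((fun t : ℝ => f ((Matrix.of A).mulVec b + t • (fun j => A j i))) + (fun t => lam * |b i + t|)) 0 := by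
    apply Filter.Eventually.of_forall
    intro t
    obtain ⟨v, hv⟩ : ∃ v : Fin p → ℝ, v = b + t • (Pi.single i (1:ℝ) : Fin p → ℝ) := ⟨_, rfl⟩
    have := hb v
    have e1 : (Matrix.of A).mulVec v = (Matrix.of A).mulVec b + t • (fun j => A j i) := by
      rw [hv, mulVec_add, mulVec_smul]
      congr 2
      ext j; simp
    have e3 : v i = b i + t := by simp [hv]
    rw [e1, ← Finset.add_sum_erase _ (fun l => |b l|) (Finset.mem_univ i),
      ← Finset.add_sum_erase _ (fun l => |v l|) (Finset.mem_univ i)] at this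
    have e2 : ∑ l ∈ Finset.univ.erase i, |v l| = ∑ l ∈ Finset.univ.erase i, |b l| := by
      apply Finset.sum_congr rfl
      intro l hl
      simp [hv, Finset.ne_of_mem_erase hl]
    rw [e2, e3] at this
    simp at this ⊢
    linarith
  have := hmin.hasDerivAt_eq_zero h3
  linarith

theorem fit_unique {n p : ℕ} (f : (Fin n → ℝ) → ℝ) 
    (hconv : StrictConvexOn ℝ Set.univ f)
    (A : Fin n → Fin p → ℝ) (lam : ℝ) (hl : 0 < lam) (b b' : Fin p → ℝ)
    (hb : ∀ β : Fin p → ℝ,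
            f ((Matrix.of A).mulVec b) + lam * ∑ i, |b i| ≤
              f ((Matrix.of A).mulVec β) + lam * ∑ i, |β i|)
    (hb' : ∀ β : Fin p → ℝ,
            f ((Matrix.of A).mulVec b') + lam * ∑ i, |b' i| ≤
              f ((Matrix.of A).mulVec β) + lam * ∑ i, |β i|) :
    (Matrix.of A).mulVec b = (Matrix.of A).mulVec b' := by
  by_contra hne
  have h := hconv.2 (Set.mem_univ _) (Set.mem_univ _) hne (show (0:ℝ) < 1/2 by norm_num)
    (show (0:ℝ) < 1/2 by norm_num) (by norm_num)
  rw [← mulVec_smul, ← mulVec_smul, ← mulVec_add] at h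
  have h1 := hb ((1/2:ℝ) • b + (1/2:ℝ) • b')
  have h2 := hb' b
  have h3 : ∑ i, |((1/2:ℝ) • b + (1/2:ℝ) • b') i| ≤ (1/2) * ∑ i, |b i| + (1/2) * ∑ i, |b' i| := by
    rw [Finset.mul_sum, Finset.mul_sum, ← Finset.sum_add_distrib]
    apply Finset.sum_le_sum
    intro i _
    simp only [Pi.add_apply, Pi.smul_apply, smul_eq_mul]
    refine (abs_add_le _ _).trans ?_
    rw [abs_mul, abs_mul]; norm_num
  have h4 := mul_le_mul_of_nonneg_left h3 hl.le
  simp only [smul_eq_mul] at h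
  linarith [hb b']

/-- For a differentiable strictly convex loss f, for
Lebesgue-almost every X and every λ > 0, the ℓ₁ penalized problem
min_β f(Xβ) + λ‖β‖₁ has at most one minimizer, and any minimizer has at most
min{n,p} nonzero components. -/
theorem stmt9 {n p : ℕ} (f : (Fin n → ℝ) → ℝ) (hdiff : Differentiable ℝ f)
    (hconv : StrictConvexOn ℝ Set.univ f) :
    ∀ᵐ A ∂(volume : Measure (Fin n → Fin p → ℝ)),
      ∀ lam : ℝ, 0 < lam →
        {b : Fin p → ℝ | ∀ β : Fin p → ℝ,
          f ((Matrix.of A).mulVec b) + lam * ∑ i, |b i| ≤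
            f ((Matrix.of A).mulVec β) + lam * ∑ i, |β i|}.Subsingleton ∧
        ∀ b : Fin p → ℝ,
          (∀ β : Fin p → ℝ,
            f ((Matrix.of A).mulVec b) + lam * ∑ i, |b i| ≤
              f ((Matrix.of A).mulVec β) + lam * ∑ i, |β i|) →
          {i : Fin p | b i ≠ 0}.ncard ≤ min n p := by
  have hae : ∀ᵐ A ∂(volume : Measure (Fin n → Fin p → ℝ)),
      ∀ k : ℕ, ∀ hk : k ≤ n, ∀ e : Fin (k+1) → Fin p, Function.Injective e →
      ∀ s : Fin p → SignType, s (e 0) ≠ 0 → (brd hk e s A).det ≠ 0 := by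
    rw [ae_all_iff]; intro k
    rw [ae_all_iff]; intro hk
    rw [ae_all_iff]; intro e
    rw [ae_all_iff]; intro he
    rw [ae_all_iff]; intro s
    rw [ae_all_iff]; intro hs
    exact brd_ae hk e he s hs
  filter_upwards [hae] with A hA lam hl
  -- the equicorrelation set of a minimizer
  have key : ∀ b : Fin p → ℝ, ∃ E : Finset (Fin p), E.card ≤ n ∧
      (∀ b' : Fin p → ℝ, (Matrix.of A).mulVec b' = (Matrix.of A).mulVec b →
        (∀ β : Fin p → ℝ, f ((Matrix.of A).mulVec b') + lam * ∑ i, |b' i| ≤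
              f ((Matrix.of A).mulVec β) + lam * ∑ i, |β i|) → ∀ i ∉ E, b' i = 0) ∧
      ∀ c : Fin p → ℝ, (∀ i ∉ E, c i = 0) → (Matrix.of A).mulVec c = 0 → c = 0 := by
    intro b
    classical
    let g := fderiv ℝ f ((Matrix.of A).mulVec b)
    let s : Fin p → SignType := fun i => SignType.sign (-g (fun j => A j i))
    let E : Finset (Fin p) := Finset.univ.filter fun i => |g (fun j => A j i)| = lam
    have hsE : ∀ i ∈ E, s i ≠ 0 := by
      intro i hi h
      have hi' : |g (fun j => A j i)| = lam := by simpa [E] using hi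
      have : g (fun j => A j i) = 0 := by simpa [s] using h
      rw [this] at hi'; simp at hi'; linarith
    have hgE : ∀ i ∈ E, g (fun j => A j i) = -lam * ((s i : SignType) : ℝ) := by
      intro i hi
      have hi' : |g (fun j => A j i)| = lam := by simpa [E] using hi
      have := abs_mul_sign (-g (fun j => A j i))
      rw [abs_neg, hi'] at this
      simp only [s]
      linarith
    have hker : ∀ T ⊆ E, T.card ≤ n + 1 → ∀ c : Fin p → ℝ, (∀ i ∉ T, c i = 0) →
        (Matrix.of A).mulVec c = 0 → c = 0 := fun T hT hTc c hc h0 =>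
      ker_zero A hA g lam hl s T (fun i hi => hsE i (hT hi)) (fun i hi => hgE i (hT hi)) hTc c hc h0
    have hcard : E.card ≤ n := by
      by_contra hlt
      obtain ⟨T, hT, hTc⟩ := Finset.exists_subset_card_eq (show n + 1 ≤ E.card by omega)
      have hli : LinearIndependent ℝ (fun i : T => (fun j => A j i : Fin n → ℝ)) := by
        rw [Fintype.linearIndependent_iff]
        intro c hc i
        have := hker T hT hTc.le (fun l => if h : l ∈ T then c ⟨l, h⟩ else 0)
          (fun l hl => by simp [hl]) (by
            ext j
            have h1 := congrFun hc j
            simp only [Finset.sum_apply, Pi.smul_apply, smul_eq_mul, Pi.zero_apply] at h1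
            simp only [mulVec, dotProduct, of_apply, Pi.zero_apply]
            refine Eq.trans ?_ h1
            rw [← Finset.sum_subset (Finset.subset_univ T) (by intro l _ hl; simp [hl]),
              ← Finset.sum_coe_sort T]
            apply Finset.sum_congr rfl
            intro l _
            simp [mul_comm])
        have h2 := congrFun this i
        simpa using h2
      have := hli.fintype_card_le_finrank
      simp [hTc] at this
    refine ⟨E, hcard, ?_, hker E subset_rfl (by omega)⟩
    intro b' hbb hb' i hi
    by_contra hne
    apply hi
    have := kkt f hdiff A lam b' hb' i hne
    rw [hbb] at this
    simp only [E, Finset.mem_filter, Finset.mem_univ, true_and]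
    change |fderiv ℝ f ((Matrix.of A).mulVec b) _| = lam
    rw [this, abs_mul, abs_neg, abs_of_pos hl]
    rcases lt_or_gt_of_ne hne with h | h <;> simp [h]
  refine ⟨?_, ?_⟩
  · intro b hb b' hb'
    obtain ⟨E, -, h1, h2⟩ := key b
    have hf := fit_unique f hconv A lam hl b b' hb hb'
    have := h2 (b - b') (fun i hi => by
      rw [Pi.sub_apply, h1 b rfl hb i hi, h1 b' hf.symm hb' i hi, sub_zero]) (by
      rw [mulVec_sub, hf, sub_self])
    exact sub_eq_zero.1 this
  · intro b hb
    obtain ⟨E, hE, h1, -⟩ := key b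
    refine le_min ?_ ?_
    · refine le_trans ?_ hE
      rw [← Set.ncard_coe_finset]
      apply Set.ncard_le_ncard _ (Finset.finite_toSet E)
      intro i hi
      by_contra h
      exact hi (h1 b rfl hb i h)
    · refine (Set.ncard_le_ncard (Set.subset_univ _)).trans ?_
      simp [Set.ncard_univ]
end

section
/- Fix y ∈ ℝⁿ, X ∈ ℝ^{n×p}, and λ > 0, and let E and s be the equicorrelation set and signs. Then: (a) every lasso solution β̂ satisfies β̂ᵢ = 0 for all i ∉ E; (b) if β⁽¹⁾ and β⁽²⁾ are two lasso solutions, then the difference of their equicorrelation blocks satisfies β⁽¹⁾_E − β⁽²⁾_E ∈ null(X_E); and (c) conversely, if β̂ is a lasso solution and b ∈ null(X_E) satisfies s_i · (β̂_i + b_i) ≥ 0 for all i ∈ E, then the vector β̃ defined by β̃ᵢ = 0 for i ∉ E and β̃_E = β̂_E + b is also a lasso solution. -/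
open Matrix BigOperators Filter MeasureTheory

theorem corr_dot {n p : ℕ} (y : Fin n → ℝ) (X : Matrix (Fin n) (Fin p) ℝ)
    (b d : Fin p → ℝ) :
    ∑ j, (y j - X.mulVec b j) * X.mulVec d j = ∑ i, corr y X b i * d i := by
  simp only [corr, Finset.sum_mul]
  rw [Finset.sum_comm]
  refine Finset.sum_congr rfl fun j _ => ?_
  have hd : X.mulVec d j = ∑ i, X j i * d i := rfl
  rw [hd, Finset.mul_sum]
  refine Finset.sum_congr rfl fun i _ => ?_
  ring

theorem obj_add {n p : ℕ} (y : Fin n → ℝ) (X : Matrix (Fin n) (Fin p) ℝ) (lam : ℝ)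
    (b d : Fin p → ℝ) :
    lassoObj y X lam (b + d) = lassoObj y X lam b - ∑ i, corr y X b i * d i
      + (1 / 2) * ∑ j, (X.mulVec d j) ^ 2 + lam * ∑ i, (|b i + d i| - |b i|) := by
  rw [← corr_dot]
  simp only [lassoObj, Matrix.mulVec_add, Pi.add_apply, Finset.sum_sub_distrib]
  have : ∑ j, (y j - (X.mulVec b j + X.mulVec d j)) ^ 2 = ∑ j, (y j - X.mulVec b j) ^ 2
      - 2 * ∑ j, (y j - X.mulVec b j) * X.mulVec d j + ∑ j, (X.mulVec d j) ^ 2 := by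
    rw [Finset.mul_sum, ← Finset.sum_sub_distrib, ← Finset.sum_add_distrib]
    exact Finset.sum_congr rfl fun j _ => by ring
  rw [this]; ring

theorem small_le {a k : ℝ} (h : ∀ e : ℝ, 0 < e → e < 1 → a ≤ e * k) : a ≤ 0 := by
  by_contra! ha
  have hk : a < k := by
    have := h (1/2) (by norm_num) (by norm_num)
    linarith
  have hk0 : 0 < k := ha.trans hk
  have := h (a / (2 * k)) (by positivity) (by rw [div_lt_one (by linarith)]; linarith)
  have h2 : a / (2 * k) * k = a / 2 := by field_simp
  linarith

theorem kkt_ineq {n p : ℕ} {y : Fin n → ℝ} {X : Matrix (Fin n) (Fin p) ℝ} {lam : ℝ}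
    {b : Fin p → ℝ} (hb : IsLassoSol y X lam b) (i : Fin p) : ∃ K : ℝ, ∀ t : ℝ,
    corr y X b i * t ≤ t ^ 2 * K + lam * (|b i + t| - |b i|) := by
  refine ⟨(1 / 2) * ∑ j, (X j i) ^ 2, fun t => ?_⟩
  have h := hb (b + Pi.single i t)
  rw [obj_add] at h
  have h1 : ∑ k, corr y X b k * (Pi.single i t : Fin p → ℝ) k = corr y X b i * t := by
    rw [Finset.sum_eq_single i] <;> simp +contextual
  have h2 : ∑ k, (|b k + (Pi.single i t : Fin p → ℝ) k| - |b k|) = |b i + t| - |b i| := by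
    rw [Finset.sum_eq_single i] <;> simp +contextual
  have h3 : ∑ j, (X.mulVec (Pi.single i t) j) ^ 2 = t ^ 2 * ∑ j, (X j i) ^ 2 := by
    rw [Finset.mul_sum]
    refine Finset.sum_congr rfl fun j _ => ?_
    simp [Matrix.mulVec_single, mul_pow, mul_comm]
  rw [h1, h2, h3] at h
  linarith

theorem kkt_s10 {n p : ℕ} {y : Fin n → ℝ} {X : Matrix (Fin n) (Fin p) ℝ} {lam : ℝ}
    (hlam : 0 < lam)
    {b : Fin p → ℝ} (hb : IsLassoSol y X lam b) (i : Fin p) :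
    |corr y X b i| ≤ lam ∧ corr y X b i * b i = lam * |b i| := by
  obtain ⟨K, hK⟩ := kkt_ineq hb i
  set c := corr y X b i
  have h1 : |c| ≤ lam := by
    rw [abs_le']
    constructor
    · have := small_le (a := c - lam) (k := K) fun e he _ => by
        have h := hK e
        have h2 : |b i + e| - |b i| ≤ e := by
          have := abs_add_le (b i) e
          rw [abs_of_pos he] at this; linarith
        have h3 := mul_le_mul_of_nonneg_left h2 hlam.le
        have h4 : e * (c - lam) ≤ e * (e * K) := by nlinarith
        exact le_of_mul_le_mul_left h4 he
      linarith
    · have := small_le (a := - c - lam) (k := K) fun e he _ => by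
        have h := hK (-e)
        have h2 : |b i + -e| - |b i| ≤ e := by
          have := abs_add_le (b i) (-e)
          rw [abs_neg, abs_of_pos he] at this; linarith
        have h3 := mul_le_mul_of_nonneg_left h2 hlam.le
        have h4 : e * (- c - lam) ≤ e * (e * K) := by nlinarith
        exact le_of_mul_le_mul_left h4 he
      linarith
  refine ⟨h1, le_antisymm ?_ ?_⟩
  · calc c * b i ≤ |c * b i| := le_abs_self _
      _ = |c| * |b i| := abs_mul _ _
      _ ≤ _ := mul_le_mul_of_nonneg_right h1 (abs_nonneg _)
  · have := small_le (a := lam * |b i| - c * b i) (k := (b i)^2 * K) fun e he he1 => by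
      have h := hK (-(e * b i))
      have h2 : |b i + -(e * b i)| = (1 - e) * |b i| := by
        rw [show b i + -(e * b i) = (1 - e) * b i by ring, abs_mul,
          abs_of_pos (by linarith : 0 < 1 - e)]
      rw [h2] at h
      have h4 : e * (lam * |b i| - c * b i) ≤ e * (e * ((b i)^2 * K)) := by linarith
      exact le_of_mul_le_mul_left h4 he
    linarith

theorem kkt_suff {n p : ℕ} {y : Fin n → ℝ} {X : Matrix (Fin n) (Fin p) ℝ} {lam : ℝ}
    {b : Fin p → ℝ}
    (h : ∀ i, |corr y X b i| ≤ lam ∧ corr y X b i * b i = lam * |b i|) :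
    IsLassoSol y X lam b := by
  intro β
  have e := obj_add y X lam b (β - b)
  rw [add_sub_cancel] at e
  have h1 : 0 ≤ ∑ j, (X.mulVec (β - b) j) ^ 2 := Finset.sum_nonneg fun _ _ => sq_nonneg _
  have h2 : ∑ i, corr y X b i * (β - b) i ≤ lam * ∑ i, (|b i + (β - b) i| - |b i|) := by
    rw [Finset.mul_sum]
    refine Finset.sum_le_sum fun i _ => ?_
    obtain ⟨ha, hb⟩ := h i
    have : corr y X b i * β i ≤ lam * |β i| :=
      calc corr y X b i * β i ≤ |corr y X b i * β i| := le_abs_self _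
        _ = |corr y X b i| * |β i| := abs_mul _ _
        _ ≤ _ := mul_le_mul_of_nonneg_right ha (abs_nonneg _)
    simp only [Pi.sub_apply, add_sub_cancel]
    linarith
  linarith

theorem fit_unique_s10 {n p : ℕ} {y : Fin n → ℝ} {X : Matrix (Fin n) (Fin p) ℝ} {lam : ℝ}
    (hlam : 0 < lam) {b β : Fin p → ℝ} (hb : IsLassoSol y X lam b)
    (hβ : IsLassoSol y X lam β) : X.mulVec (β - b) = 0 := by
  have e := obj_add y X lam b (β - b)
  rw [add_sub_cancel] at e
  have h0 := hβ b
  have h2 : ∑ i, corr y X b i * (β - b) i ≤ lam * ∑ i, (|b i + (β - b) i| - |b i|) := by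
    rw [Finset.mul_sum]
    refine Finset.sum_le_sum fun i _ => ?_
    obtain ⟨ha, hb⟩ := kkt_s10 hlam hb i
    have : corr y X b i * β i ≤ lam * |β i| :=
      calc corr y X b i * β i ≤ |corr y X b i * β i| := le_abs_self _
        _ = |corr y X b i| * |β i| := abs_mul _ _
        _ ≤ _ := mul_le_mul_of_nonneg_right ha (abs_nonneg _)
    simp only [Pi.sub_apply, add_sub_cancel]
    linarith
  have h1 : ∑ j, (X.mulVec (β - b) j) ^ 2 = 0 :=
    le_antisymm (by linarith) (Finset.sum_nonneg fun _ _ => sq_nonneg _)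
  rw [Finset.sum_eq_zero_iff_of_nonneg fun _ _ => sq_nonneg _] at h1
  funext j
  exact pow_eq_zero_iff (two_ne_zero) |>.1 (h1 j (Finset.mem_univ _))

theorem corr_congr {n p : ℕ} (y : Fin n → ℝ) {X : Matrix (Fin n) (Fin p) ℝ}
    {b β : Fin p → ℝ} (h : X.mulVec (β - b) = 0) (i : Fin p) :
    corr y X β i = corr y X b i := by
  rw [Matrix.mulVec_sub, sub_eq_zero] at h
  simp only [corr, h]

theorem colSub_mulVec {n p : ℕ} (X : Matrix (Fin n) (Fin p) ℝ) (E : Finset (Fin p))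
    (v : ↥E → ℝ) (d : Fin p → ℝ) (h1 : ∀ i : ↥E, d i = v i) (h2 : ∀ i ∉ E, d i = 0) :
    (colSub X E).mulVec v = X.mulVec d := by
  funext j
  simp only [Matrix.mulVec, dotProduct, colSub]
  rw [← Finset.sum_subset (Finset.subset_univ E) (fun i _ hi => by rw [h2 i hi, mul_zero]),
    ← Finset.sum_coe_sort E]
  exact Finset.sum_congr rfl fun i _ => by rw [h1]

/-- (a) every lasso solution vanishes off the equicorrelation set
E; (b) the difference of the E-blocks of two solutions lies in null(X_E);
(c) perturbing a solution's E-block by b ∈ null(X_E) satisfying the sign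
condition s_i(β̂_i + b_i) ≥ 0 yields another lasso solution. -/
theorem stmt10 {n p : ℕ} (y : Fin n → ℝ) (X : Matrix (Fin n) (Fin p) ℝ) (lam : ℝ)
    (hlam : 0 < lam) (β₀ : Fin p → ℝ) (hβ₀ : IsLassoSol y X lam β₀) :
    (∀ b : Fin p → ℝ, IsLassoSol y X lam b → ∀ i ∉ equiSet y X lam β₀, b i = 0) ∧
    (∀ b₁ b₂ : Fin p → ℝ, IsLassoSol y X lam b₁ → IsLassoSol y X lam b₂ →
      (colSub X (equiSet y X lam β₀)).mulVec
        (fun i : ↥(equiSet y X lam β₀) => b₁ i.1 - b₂ i.1) = 0) ∧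
    (∀ b : Fin p → ℝ, IsLassoSol y X lam b →
      ∀ v : ↥(equiSet y X lam β₀) → ℝ,
        (colSub X (equiSet y X lam β₀)).mulVec v = 0 →
        (∀ i : ↥(equiSet y X lam β₀),
          Real.sign (corr y X β₀ i.1) * (b i.1 + v i) ≥ 0) →
        IsLassoSol y X lam
          (fun i => if h : i ∈ equiSet y X lam β₀ then b i + v ⟨i, h⟩ else 0)) := by
  have hA : ∀ b : Fin p → ℝ, IsLassoSol y X lam b → ∀ i ∉ equiSet y X lam β₀, b i = 0 := by
    intro b hb i hi
    obtain ⟨h1, h2⟩ := kkt_s10 hlam hb i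
    have hc := corr_congr y (fit_unique_s10 hlam hβ₀ hb) i
    have hne : |corr y X b i| ≠ lam := by
      rw [hc]; simpa [equiSet] using hi
    have hlt := lt_of_le_of_ne h1 hne
    by_contra hbi
    have hpos := abs_pos.2 hbi
    have h3 : corr y X b i * b i ≤ |corr y X b i| * |b i| := by
      rw [← abs_mul]; exact le_abs_self _
    nlinarith
  refine ⟨hA, ?_, ?_⟩
  · intro b₁ b₂ h₁ h₂
    refine (colSub_mulVec X _ _ (b₁ - b₂) (fun i => rfl)
      (fun i hi => by simp [hA b₁ h₁ i hi, hA b₂ h₂ i hi])).trans ?_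
    exact fit_unique_s10 hlam h₂ h₁
  · intro b hb v hv hs
    set β : Fin p → ℝ :=
      fun i => if h : i ∈ equiSet y X lam β₀ then b i + v ⟨i, h⟩ else 0 with hβ
    have hX : X.mulVec (β - b) = 0 := by
      rw [← hv]
      symm
      apply colSub_mulVec
      · intro i
        simp [hβ, i.2]
      · intro i hi
        simp [hβ, hi, hA b hb i hi]
    apply kkt_suff
    intro i
    rw [corr_congr y hX i]
    refine ⟨(kkt_s10 hlam hb i).1, ?_⟩
    by_cases hi : i ∈ equiSet y X lam β₀
    · have hβi : β i = b i + v ⟨i, hi⟩ := by simp [hβ, hi]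
      have hsi := hs ⟨i, hi⟩
      simp only at hsi
      rw [← hβi] at hsi
      have habs : |corr y X β₀ i| = lam := by simpa [equiSet] using hi
      rw [corr_congr y (fit_unique_s10 hlam hβ₀ hb) i]
      rcases lt_trichotomy (corr y X β₀ i) 0 with h | h | h
      · rw [Real.sign_of_neg h] at hsi
        rw [abs_of_neg h] at habs
        rw [abs_of_nonpos (by linarith), ← habs]; ring
      · rw [h, abs_zero] at habs; linarith
      · rw [Real.sign_of_pos h] at hsi
        rw [abs_of_pos h] at habs
        rw [abs_of_nonneg (by linarith), ← habs]
    · have hβi : β i = 0 := by simp [hβ, hi]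
      simp [hβi]
end

section
/- Fix y ∈ ℝⁿ and X ∈ ℝ^{n×p}. Let (λ_k) be a sequence of positive reals with λ_k → 0, and for each k let β⁽ᵏ⁾ be a lasso solution at tuning parameter λ_k. If β⁽ᵏ⁾ converges to some β* ∈ ℝ^p, then β* is a least squares solution (i.e., β* minimizes ‖y − Xβ‖₂² over β ∈ ℝ^p), and ‖β*‖₁ ≤ ‖β‖₁ for every least squares solution β; that is, β* is a minimum ℓ₁ norm least squares solution. -/
open Matrix BigOperators Filter MeasureTheory

/-- If λ_k → 0 (λ_k > 0), β⁽ᵏ⁾ are lasso solutions at λ_k, and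
β⁽ᵏ⁾ → β*, then β* is a least squares solution of minimum ℓ₁ norm among all
least squares solutions. -/
theorem stmt12 {n p : ℕ} (y : Fin n → ℝ) (X : Matrix (Fin n) (Fin p) ℝ)
    (lam : ℕ → ℝ) (hpos : ∀ k, 0 < lam k)
    (hlam : Tendsto lam atTop (nhds 0))
    (b : ℕ → Fin p → ℝ) (hsol : ∀ k, IsLassoSol y X (lam k) (b k))
    (bstar : Fin p → ℝ) (hconv : Tendsto b atTop (nhds bstar)) :
    (∀ β : Fin p → ℝ,
      ∑ j, (y j - X.mulVec bstar j) ^ 2 ≤ ∑ j, (y j - X.mulVec β j) ^ 2) ∧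
    ∀ β : Fin p → ℝ,
      (∀ β' : Fin p → ℝ,
        ∑ j, (y j - X.mulVec β j) ^ 2 ≤ ∑ j, (y j - X.mulVec β' j) ^ 2) →
      ∑ i, |bstar i| ≤ ∑ i, |β i| := by
  have h1 : Tendsto (fun k => ∑ j, (y j - X.mulVec (b k) j) ^ 2) atTop
      (nhds (∑ j, (y j - X.mulVec bstar j) ^ 2)) := by
    have hc : Continuous (fun β : Fin p → ℝ => ∑ j, (y j - X.mulVec β j) ^ 2) := by
      unfold Matrix.mulVec dotProduct
      fun_prop
    exact (hc.tendsto bstar).comp hconv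
  have h2 : Tendsto (fun k => ∑ i, |b k i|) atTop (nhds (∑ i, |bstar i|)) := by
    have hc : Continuous (fun β : Fin p → ℝ => ∑ i, |β i|) := by fun_prop
    exact (hc.tendsto bstar).comp hconv
  refine ⟨fun β => ?_, fun β hβ => ?_⟩
  · have h3 := (h1.const_mul (1 / 2)).add (hlam.mul h2)
    have h4 := (hlam.mul_const (∑ i, |β i|)).const_add
      ((1 / 2) * ∑ j, (y j - X.mulVec β j) ^ 2)
    have := le_of_tendsto_of_tendsto' h3 h4 (fun k => hsol k β)
    linarith
  · refine le_of_tendsto' h2 (fun k => ?_)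
    have h3 := hsol k β
    have h4 := hβ (b k)
    unfold lassoObj at h3
    exact le_of_mul_le_mul_left (by linarith) (hpos k)
end

section
/- Fix X ∈ ℝ^{n×p} and λ₁ > 0. For Lebesgue-almost every y ∈ ℝⁿ, the unique elastic net solution β̂ᴱᴺ(λ₁,λ₂) converges, as λ₂ → 0⁺, to the lasso solution at tuning parameter λ₁ of minimal ℓ₂ norm. -/
open Matrix BigOperators Filter MeasureTheory

/-- The elastic net criterion: (1/2)‖y − Xβ‖₂² + λ₁‖β‖₁ + (λ₂/2)‖β‖₂². -/
noncomputable def enObj {n p : ℕ} (y : Fin n → ℝ) (X : Matrix (Fin n) (Fin p) ℝ)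
    (lam1 lam2 : ℝ) (β : Fin p → ℝ) : ℝ :=
  (1 / 2) * ∑ j, (y j - X.mulVec β j) ^ 2 + lam1 * ∑ i, |β i| +
    (lam2 / 2) * ∑ i, (β i) ^ 2

/-- For fixed X and λ₁ > 0, for almost every y, the (unique)
elastic net solution β̂ᴱᴺ(λ₁,λ₂) converges as λ₂ → 0⁺ to the lasso solution at
λ₁ of minimal ℓ₂ norm. -/
theorem stmt13 {n p : ℕ} (X : Matrix (Fin n) (Fin p) ℝ) (lam1 : ℝ)
    (hlam1 : 0 < lam1) :
    ∀ᵐ y ∂(volume : Measure (Fin n → ℝ)),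
      ∀ bL : Fin p → ℝ, IsLassoSol y X lam1 bL →
        (∀ b : Fin p → ℝ, IsLassoSol y X lam1 b →
          Real.sqrt (∑ i, bL i ^ 2) ≤ Real.sqrt (∑ i, b i ^ 2)) →
        ∀ EN : ℝ → Fin p → ℝ,
          (∀ lam2 : ℝ, 0 < lam2 →
            ∀ β : Fin p → ℝ, enObj y X lam1 lam2 (EN lam2) ≤ enObj y X lam1 lam2 β) →
          Tendsto EN (nhdsWithin 0 (Set.Ioi 0)) (nhds bL) := by
  refine Filter.Eventually.of_forall ?_
  intro y bL hL hmin EN hEN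
  have hcont : Continuous (lassoObj y X lam1) := by
    unfold lassoObj Matrix.mulVec dotProduct
    fun_prop
  have hrel : ∀ l b, enObj y X lam1 l b = lassoObj y X lam1 b + (l / 2) * ∑ i, (b i) ^ 2 := by
    intro l b; rfl
  have hnn : ∀ b : Fin p → ℝ, 0 ≤ ∑ i, b i ^ 2 := fun b => Finset.sum_nonneg fun i _ => sq_nonneg _
  have hnorm : ∀ l, 0 < l → ∑ i, (EN l i) ^ 2 ≤ ∑ i, bL i ^ 2 := by
    intro l hl
    have h1 := hEN l hl bL
    have h2 := hL (EN l)
    rw [hrel, hrel] at h1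
    have h3 : (l / 2) * ∑ i, (EN l i) ^ 2 ≤ (l / 2) * ∑ i, bL i ^ 2 := by linarith
    exact le_of_mul_le_mul_left h3 (by positivity)
  have hval : ∀ l, 0 < l →
      lassoObj y X lam1 (EN l) - (l / 2) * ∑ i, bL i ^ 2 ≤ lassoObj y X lam1 bL := by
    intro l hl
    have h1 := hEN l hl bL
    rw [hrel, hrel] at h1
    have : 0 ≤ (l / 2) * ∑ i, (EN l i) ^ 2 := mul_nonneg (by positivity) (hnn _)
    linarith
  have hcn : Continuous (fun b : Fin p → ℝ => ∑ i, b i ^ 2) := by fun_prop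
  have hK : IsCompact {b : Fin p → ℝ | ∑ i, b i ^ 2 ≤ ∑ i, bL i ^ 2} := by
    refine Metric.isCompact_of_isClosed_isBounded (isClosed_le hcn continuous_const) ?_
    refine (Metric.isBounded_iff_subset_closedBall 0).2 ⟨Real.sqrt (∑ i, bL i ^ 2), ?_⟩
    intro b hb
    rw [mem_closedBall_zero_iff, pi_norm_le_iff_of_nonneg (Real.sqrt_nonneg _)]
    intro i
    rw [Real.norm_eq_abs]
    apply Real.abs_le_sqrt
    exact (Finset.single_le_sum (f := fun i => b i ^ 2) (fun i _ => sq_nonneg _)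
      (Finset.mem_univ i)).trans hb
  refine hK.tendsto_nhds_of_unique_mapClusterPt ?_ ?_
  · filter_upwards [self_mem_nhdsWithin] with l hl using hnorm l hl
  intro b hb hcl
  have hfb : lassoObj y X lam1 b ≤ lassoObj y X lam1 bL := by
    refine le_of_forall_pos_le_add fun ε hε => ?_
    have hcl' : IsClosed {b | lassoObj y X lam1 b ≤ lassoObj y X lam1 bL + ε} :=
      isClosed_le hcont continuous_const
    refine hcl'.mem_of_mapClusterPt hcl ?_
    have ht : Tendsto (fun l : ℝ => (l / 2) * ∑ i, bL i ^ 2) (nhdsWithin 0 (Set.Ioi 0))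
        (nhds 0) := by
      have : Continuous (fun l : ℝ => (l / 2) * ∑ i, bL i ^ 2) := by fun_prop
      have h := this.tendsto 0
      simp only [zero_div, zero_mul] at h
      exact h.mono_left nhdsWithin_le_nhds
    filter_upwards [self_mem_nhdsWithin, ht.eventually_lt_const hε] with l hl hl2
    have := hval l hl
    show lassoObj y X lam1 (EN l) ≤ lassoObj y X lam1 bL + ε
    linarith
  let m : Fin p → ℝ := (1 / 2 : ℝ) • b + (1 / 2 : ℝ) • bL
  have hmi : ∀ i, m i = (b i + bL i) / 2 := by
    intro i; simp [m]; ring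
  have hm : lassoObj y X lam1 m ≤ (lassoObj y X lam1 b + lassoObj y X lam1 bL) / 2 := by
    have hX : ∀ j, X.mulVec m j = (X.mulVec b j + X.mulVec bL j) / 2 := by
      intro j
      simp [m, Matrix.mulVec_add, Matrix.mulVec_smul]; ring
    have h1 : ∑ j, (y j - X.mulVec m j) ^ 2 ≤
        (∑ j, (y j - X.mulVec b j) ^ 2 + ∑ j, (y j - X.mulVec bL j) ^ 2) / 2 := by
      rw [← Finset.sum_add_distrib, Finset.sum_div]
      refine Finset.sum_le_sum fun j _ => ?_
      rw [hX]
      nlinarith [sq_nonneg (X.mulVec b j - X.mulVec bL j)]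
    have h2 : ∑ i, |m i| ≤ (∑ i, |b i| + ∑ i, |bL i|) / 2 := by
      rw [← Finset.sum_add_distrib, Finset.sum_div]
      refine Finset.sum_le_sum fun i _ => ?_
      rw [hmi, abs_div, abs_two]
      have := abs_add_le (b i) (bL i)
      linarith
    have h3 := mul_le_mul_of_nonneg_left h2 hlam1.le
    unfold lassoObj
    linarith
  have hmL : IsLassoSol y X lam1 m := fun β => by
    have := hL β
    linarith
  have h4 := (Real.sqrt_le_sqrt_iff (hnn m)).1 (hmin m hmL)
  have h5 : ∑ i, m i ^ 2 =
      (∑ i, b i ^ 2 + ∑ i, bL i ^ 2) / 2 - (∑ i, (b i - bL i) ^ 2) / 4 := by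
    rw [← Finset.sum_add_distrib, Finset.sum_div, Finset.sum_div, ← Finset.sum_sub_distrib]
    refine Finset.sum_congr rfl fun i _ => ?_
    rw [hmi]; ring
  have hb' : ∑ i, b i ^ 2 ≤ ∑ i, bL i ^ 2 := hb
  have h6 : ∑ i, (b i - bL i) ^ 2 ≤ 0 := by linarith
  have h7 := (Finset.sum_eq_zero_iff_of_nonneg (fun i _ => sq_nonneg (b i - bL i))).1
    (le_antisymm h6 (Finset.sum_nonneg fun i _ => sq_nonneg _))
  funext i
  have := h7 i (Finset.mem_univ i)
  exact sub_eq_zero.1 (pow_eq_zero_iff (two_ne_zero)|>.1 this)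
end

section
/- For any y ∈ ℝⁿ, X ∈ ℝ^{n×p}, and λ > 0, any two lasso solutions β⁽¹⁾ and β⁽²⁾ satisfy β⁽¹⁾ᵢ · β⁽²⁾ᵢ ≥ 0 for every i ∈ {1,…,p}; that is, no two lasso solutions can attach opposite signs to the same coefficient. -/
open Matrix BigOperators Filter MeasureTheory

/-- For λ > 0, any two lasso solutions have consistent signs:
β⁽¹⁾ᵢ · β⁽²⁾ᵢ ≥ 0 for every i. -/
theorem stmt14 {n p : ℕ} (y : Fin n → ℝ) (X : Matrix (Fin n) (Fin p) ℝ) (lam : ℝ)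
    (hlam : 0 < lam) (b₁ b₂ : Fin p → ℝ)
    (h₁ : IsLassoSol y X lam b₁) (h₂ : IsLassoSol y X lam b₂) :
    ∀ i : Fin p, 0 ≤ b₁ i * b₂ i := by
  intro i
  by_contra hneg
  push Not at hneg
  have a₁ := h₁ (fun k => (b₁ k + b₂ k) / 2)
  have a₂ := h₂ (fun k => (b₁ k + b₂ k) / 2)
  unfold lassoObj at a₁ a₂
  have hm : ∀ j, X.mulVec (fun k => (b₁ k + b₂ k) / 2) j
      = (X.mulVec b₁ j + X.mulVec b₂ j) / 2 := by
    intro j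
    simp only [Matrix.mulVec, dotProduct]
    rw [← Finset.sum_add_distrib, Finset.sum_div]
    exact Finset.sum_congr rfl fun k _ => by ring
  have hq : ∑ j, (y j - X.mulVec (fun k => (b₁ k + b₂ k) / 2) j) ^ 2
      ≤ (∑ j, (y j - X.mulVec b₁ j) ^ 2 + ∑ j, (y j - X.mulVec b₂ j) ^ 2) / 2 := by
    rw [← Finset.sum_add_distrib, Finset.sum_div]
    refine Finset.sum_le_sum fun j _ => ?_
    rw [hm]
    nlinarith [sq_nonneg (X.mulVec b₁ j - X.mulVec b₂ j)]
  have hl : ∑ k, |(b₁ k + b₂ k) / 2| < (∑ k, |b₁ k| + ∑ k, |b₂ k|) / 2 := by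
    rw [← Finset.sum_add_distrib, Finset.sum_div]
    refine Finset.sum_lt_sum (fun k _ => ?_) ⟨i, Finset.mem_univ i, ?_⟩
    · rw [abs_div, abs_two]
      linarith [abs_add_le (b₁ k) (b₂ k)]
    · rw [abs_div, abs_two]
      rcases mul_neg_iff.mp hneg with ⟨h, h'⟩ | ⟨h, h'⟩
      · rw [abs_of_pos h, abs_of_neg h']
        have : |b₁ i + b₂ i| < b₁ i + -b₂ i := abs_lt.mpr ⟨by linarith, by linarith⟩
        linarith
      · rw [abs_of_neg h, abs_of_pos h']
        have : |b₁ i + b₂ i| < -b₁ i + b₂ i := abs_lt.mpr ⟨by linarith, by linarith⟩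
        linarith
  have hl' := mul_lt_mul_of_pos_left hl hlam
  linarith
end

section
/- For any y ∈ ℝⁿ, X ∈ ℝ^{n×p}, and λ > 0, there exists a lasso solution β̂ whose active variables are linearly independent, i.e., the columns {X_i : i ∈ supp(β̂)} are linearly independent (equivalently rank(X_A) = |A| where A = supp(β̂)); in particular, there exists a lasso solution whose support has size at most min{n,p}. -/
open Matrix BigOperators Filter MeasureTheory

theorem lasso_exists {n p : ℕ} (y : Fin n → ℝ) (X : Matrix (Fin n) (Fin p) ℝ) (lam : ℝ)
    (hlam : 0 < lam) : ∃ b : Fin p → ℝ, IsLassoSol y X lam b := by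
  have hc : Continuous (lassoObj y X lam) := by
    unfold lassoObj Matrix.mulVec dotProduct
    fun_prop
  have ht : Tendsto (lassoObj y X lam) (cocompact (Fin p → ℝ)) atTop := by
    have h1 : Tendsto (fun β : Fin p → ℝ => lam * ‖β‖) (cocompact (Fin p → ℝ)) atTop :=
      (tendsto_norm_cocompact_atTop).const_mul_atTop hlam
    refine tendsto_atTop_mono (fun β => ?_) h1
    have h2 : ‖β‖ ≤ ∑ i, |β i| := by
      rw [pi_norm_le_iff_of_nonneg (Finset.sum_nonneg fun i _ => abs_nonneg _)]
      intro i
      rw [Real.norm_eq_abs]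
      exact Finset.single_le_sum (f := fun i => |β i|) (fun i _ => abs_nonneg _)
        (Finset.mem_univ i)
    have h3 : 0 ≤ ∑ j, (y j - X.mulVec β j) ^ 2 := Finset.sum_nonneg fun i _ => sq_nonneg _
    have h4 := mul_le_mul_of_nonneg_left h2 hlam.le
    unfold lassoObj
    linarith
  exact hc.exists_forall_le ht

theorem abs_pair {x z : ℝ} (h : |z| ≤ |x|) : |x + z| + |x - z| = 2 * |x| := by
  rcases abs_cases x with ⟨h1, _⟩ | ⟨h1, _⟩ <;> rcases abs_cases z with ⟨h2, _⟩ | ⟨h2, _⟩ <;>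
  rcases abs_cases (x + z) with ⟨h3, _⟩ | ⟨h3, _⟩ <;>
  rcases abs_cases (x - z) with ⟨h4, _⟩ | ⟨h4, _⟩ <;> linarith

theorem lasso_move {n p : ℕ} (y : Fin n → ℝ) (X : Matrix (Fin n) (Fin p) ℝ) (lam : ℝ)
    (b d : Fin p → ℝ) (hb : IsLassoSol y X lam b) (hd : X.mulVec d = 0)
    (hle : ∀ i, |d i| ≤ |b i|) : IsLassoSol y X lam (b + d) := by
  have key : lassoObj y X lam (b + d) + lassoObj y X lam (b - d) = 2 * lassoObj y X lam b := by
    unfold lassoObj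
    rw [Matrix.mulVec_add, Matrix.mulVec_sub, hd, add_zero, sub_zero]
    have h : ∑ i, |(b + d) i| + ∑ i, |(b - d) i| = 2 * ∑ i, |b i| := by
      rw [← Finset.sum_add_distrib, Finset.mul_sum]
      exact Finset.sum_congr rfl fun i _ => abs_pair (hle i)
    linear_combination lam * h
  intro β
  have h1 := hb (b - d)
  have h2 := hb β
  linarith

/-- For any y, X, and λ > 0, there exists a lasso solution whose
active columns are linearly independent; in particular its support has size at
most min{n,p}. -/
theorem stmt17 {n p : ℕ} (y : Fin n → ℝ) (X : Matrix (Fin n) (Fin p) ℝ) (lam : ℝ)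
    (hlam : 0 < lam) :
    ∃ b : Fin p → ℝ, IsLassoSol y X lam b ∧
      LinearIndependent ℝ
        (fun i : {i : Fin p // b i ≠ 0} => (fun j => X j i.1 : Fin n → ℝ)) ∧
      {i : Fin p | b i ≠ 0}.ncard ≤ min n p := by
  classical
  obtain ⟨b, hb, hmin⟩ : ∃ b, IsLassoSol y X lam b ∧ ∀ b', IsLassoSol y X lam b' →
      {i : Fin p | b i ≠ 0}.ncard ≤ {i : Fin p | b' i ≠ 0}.ncard := by
    obtain ⟨b, hb, h⟩ := exists_minimalFor_of_wellFoundedLT (IsLassoSol y X lam)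
      (fun b => {i : Fin p | b i ≠ 0}.ncard) (lasso_exists y X lam hlam)
    refine ⟨b, hb, fun b' hb' => ?_⟩
    rcases le_total {i : Fin p | b i ≠ 0}.ncard {i : Fin p | b' i ≠ 0}.ncard with h1 | h1
    · exact h1
    · exact h hb' h1
  have hli : LinearIndependent ℝ
        (fun i : {i : Fin p // b i ≠ 0} => (fun j => X j i.1 : Fin n → ℝ)) := by
    by_contra hn
    obtain ⟨g, hg, ⟨i0, hi0⟩⟩ := Fintype.not_linearIndependent_iff.1 hn
    let c : Fin p → ℝ := fun k => if h : b k ≠ 0 then g ⟨k, h⟩ else 0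
    have hc0 : ∀ k, b k = 0 → c k = 0 := fun k hk => by simp [c, hk]
    have hXc : X.mulVec c = 0 := by
      ext j
      have h1 := congrFun hg j
      simp only [Finset.sum_apply, Pi.smul_apply, smul_eq_mul, Pi.zero_apply] at h1
      rw [Pi.zero_apply, ← h1]
      unfold Matrix.mulVec dotProduct
      rw [← Finset.sum_filter_of_ne (p := fun k => b k ≠ 0)
        (fun k _ hk hbk => hk (by rw [hc0 k hbk, mul_zero])),
        Finset.sum_subtype (p := fun k => b k ≠ 0) _ (by simp)]
      refine Finset.sum_congr rfl fun k _ => ?_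
      simp [c, k.2, mul_comm]
    have hci0 : c i0.1 ≠ 0 := by simpa [c, i0.2] using hi0
    obtain ⟨m, hm, hmm⟩ := Finset.exists_min_image (Finset.univ.filter fun k => c k ≠ 0)
      (fun k => |b k| / |c k|) ⟨i0.1, by simpa using hci0⟩
    have hcm : c m ≠ 0 := by simpa using hm
    have hbm : b m ≠ 0 := fun h => hcm (hc0 m h)
    have hsol := lasso_move y X lam b ((-(b m / c m)) • c) hb
      (by rw [Matrix.mulVec_smul, hXc, smul_zero]) (by
        intro k
        simp only [Pi.smul_apply, smul_eq_mul, abs_mul, abs_neg, abs_div]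
        by_cases hk : c k = 0
        · simp [hk]
        · have := hmm k (by simpa using hk)
          exact (le_div_iff₀ (abs_pos.2 hk)).1 this)
    refine absurd (hmin _ hsol) (not_le.2 (Set.ncard_lt_ncard ?_ (Set.toFinite _)))
    rw [Set.ssubset_iff_of_subset]
    · refine ⟨m, hbm, ?_⟩
      simp [hcm]
    · intro k hk hbk
      apply hk
      simp [hbk, hc0 k hbk]
  refine ⟨b, hb, hli, le_min ?_ ?_⟩
  · have := hli.fintype_card_le_finrank
    rw [Module.finrank_fin_fun, ← Nat.card_eq_fintype_card] at this
    exact this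
  · have := Set.ncard_le_card {i : Fin p | b i ≠ 0}
    simpa using this
end

section
/- Fix X ∈ ℝ^{n×p} and λ > 0. For Lebesgue-almost every y ∈ ℝⁿ, the span of the active columns is the same for every lasso solution: if β⁽¹⁾ and β⁽²⁾ are two lasso solutions with active sets A₁ = supp(β⁽¹⁾) and A₂ = supp(β⁽²⁾), then span{X_i : i ∈ A₁} = span{X_i : i ∈ A₂}. -/
open Matrix BigOperators Filter MeasureTheory

lemma aux_quad (d q B : ℝ) (hq : 0 ≤ q) (hB : 0 < B)
    (h : ∀ t : ℝ, |t| < B → 0 ≤ t * d + t ^ 2 * q) : d = 0 := by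
  by_contra hd
  have hd' : 0 < |d| := abs_pos.mpr hd
  set e := min (B / (2 * |d|)) (1 / (2 * (q + 1))) with he
  have e0 : 0 < e := lt_min (by positivity) (by positivity)
  have e1 : e * (2 * |d|) ≤ B := (le_div_iff₀ (by positivity)).mp (min_le_left _ _)
  have e2 : e * (2 * (q + 1)) ≤ 1 := (le_div_iff₀ (by positivity)).mp (min_le_right _ _)
  have h1 := h (-(e * d)) (by
    rw [abs_neg, abs_mul, abs_of_pos e0]
    nlinarith [mul_pos e0 hd'])
  have h2 : 0 < e * d ^ 2 := by positivity
  have h3 : -(e * d) * d + (-(e * d)) ^ 2 * q = e * d ^ 2 * (e * q - 1) := by ring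
  rw [h3] at h1
  have h4 : 0 ≤ e * q - 1 := nonneg_of_mul_nonneg_right h1 h2
  nlinarith

lemma aux_fit {n p : ℕ} (X : Matrix (Fin n) (Fin p) ℝ) (lam : ℝ) (hlam : 0 < lam)
    (y : Fin n → ℝ) (b₁ b₂ : Fin p → ℝ) (h₁ : IsLassoSol y X lam b₁)
    (h₂ : IsLassoSol y X lam b₂) : X.mulVec b₁ = X.mulVec b₂ := by
  have hm := h₁ ((1 / 2 : ℝ) • (b₁ + b₂))
  have hm2 := h₂ ((1 / 2 : ℝ) • (b₁ + b₂))
  simp only [lassoObj, mulVec_smul, mulVec_add, Pi.smul_apply, Pi.add_apply, smul_eq_mul] at hm hm2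
  have hs : ∑ j, (y j - 1 / 2 * (X.mulVec b₁ j + X.mulVec b₂ j)) ^ 2
      = 1 / 2 * ∑ j, (y j - X.mulVec b₁ j) ^ 2 + 1 / 2 * ∑ j, (y j - X.mulVec b₂ j) ^ 2
        - 1 / 4 * ∑ j, (X.mulVec b₁ j - X.mulVec b₂ j) ^ 2 := by
    simp only [Finset.mul_sum, ← Finset.sum_add_distrib, ← Finset.sum_sub_distrib]
    exact Finset.sum_congr rfl fun j _ => by ring
  have ha : ∑ i, |1 / 2 * (b₁ i + b₂ i)| ≤ 1 / 2 * ∑ i, |b₁ i| + 1 / 2 * ∑ i, |b₂ i| := by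
    simp only [Finset.mul_sum, ← Finset.sum_add_distrib]
    refine Finset.sum_le_sum fun i _ => ?_
    rw [abs_mul, abs_of_pos (by norm_num : (0:ℝ) < 1 / 2)]
    linarith [abs_add_le (b₁ i) (b₂ i)]
  have ha' := mul_le_mul_of_nonneg_left ha hlam.le
  rw [hs] at hm hm2
  have h0 : ∑ j, (X.mulVec b₁ j - X.mulVec b₂ j) ^ 2 = 0 :=
    le_antisymm (by linarith) (Finset.sum_nonneg fun j _ => sq_nonneg _)
  rw [Finset.sum_eq_zero_iff_of_nonneg (fun j _ => sq_nonneg _)] at h0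
  funext j
  have := h0 j (Finset.mem_univ j)
  nlinarith [pow_eq_zero_iff (two_ne_zero) |>.mp this]

lemma aux_kkt {n p : ℕ} (X : Matrix (Fin n) (Fin p) ℝ) (lam : ℝ) (hlam : 0 < lam)
    (y : Fin n → ℝ) (b : Fin p → ℝ) (h : IsLassoSol y X lam b) (i : Fin p) (hi : b i ≠ 0) :
    |corr y X b i| = lam := by
  have key : lam * (SignType.sign (b i) : ℝ) - corr y X b i = 0 := by
    refine aux_quad _ (1 / 2 * ∑ j, X j i ^ 2) |b i| (by positivity) (abs_pos.mpr hi) ?_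
    intro t ht
    have ho := h (b + Pi.single i t)
    simp only [lassoObj, mulVec_add, Pi.add_apply, mulVec_single, Matrix.col_apply,
      MulOpposite.smul_eq_mul_unop, MulOpposite.unop_op, Pi.smul_apply] at ho
    have hs : ∑ j, (y j - (X.mulVec b j + X j i * t)) ^ 2
        = ∑ j, (y j - X.mulVec b j) ^ 2 - 2 * t * corr y X b i + t ^ 2 * ∑ j, X j i ^ 2 := by
      simp only [corr, Finset.mul_sum, ← Finset.sum_add_distrib, ← Finset.sum_sub_distrib]
      exact Finset.sum_congr rfl fun j _ => by ring
    have ha : ∑ k, |b k + (Pi.single i t : Fin p → ℝ) k|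
        = ∑ k, |b k| + t * (SignType.sign (b i) : ℝ) := by
      have : ∀ k, |b k + (Pi.single i t : Fin p → ℝ) k|
          = |b k| + (Pi.single i (t * (SignType.sign (b i) : ℝ)) : Fin p → ℝ) k := by
        intro k
        by_cases hk : k = i
        · subst hk
          simp only [Pi.single_eq_same]
          rcases lt_or_gt_of_ne hi with hb | hb
          · rw [abs_of_neg hb] at ht ⊢
            rw [abs_of_neg (by linarith [(abs_lt.mp ht).2]), sign_neg hb]
            simp; ring
          · rw [abs_of_pos hb] at ht ⊢
            rw [abs_of_pos (by linarith [(abs_lt.mp ht).1]), sign_pos hb]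
            simp
        · simp [hk]
      simp only [this, Finset.sum_add_distrib, Finset.sum_pi_single', Finset.mem_univ, if_true]
    rw [hs, ha] at ho
    linarith
  rw [← sub_eq_zero.mp key, abs_mul, abs_of_pos hlam]
  rcases lt_or_gt_of_ne hi with hb | hb
  · simp [sign_neg hb]
  · simp [sign_pos hb]

lemma aux_proj {n p : ℕ} (X : Matrix (Fin n) (Fin p) ℝ) (A : Finset (Fin p)) (i : Fin p)
    (hi : (fun j => X j i : Fin n → ℝ) ∉ Submodule.span ℝ
      ((fun i => (fun j => X j i : Fin n → ℝ)) '' (A : Set (Fin p)))) :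
    ∃ (u : Fin n → ℝ) (c : Fin p → ℝ), u ≠ 0 ∧ (∀ k ∈ A, ∑ j, u j * X j k = 0) ∧
      ∀ j, u j = X j i - ∑ k ∈ A, c k * X j k := by
  let x : Fin p → EuclideanSpace ℝ (Fin n) := fun k => WithLp.toLp 2 (fun j => X j k)
  let V : Submodule ℝ (EuclideanSpace ℝ (Fin n)) := Submodule.span ℝ (x '' (A : Set (Fin p)))
  have hv : V.starProjection (x i) ∈ V := Submodule.starProjection_apply_mem V (x i)
  have hort := Submodule.sub_starProjection_mem_orthogonal (K := V) (x i)
  obtain ⟨c₀, hc₀⟩ := (Submodule.mem_span_image_finset_iff_exists_fun ℝ).mp hv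
  obtain ⟨c, hc⟩ : ∃ c : Fin p → ℝ, ∑ k ∈ A, c k • x k = V.starProjection (x i) := by
    classical
    refine ⟨fun k => if h : k ∈ A then c₀ ⟨k, h⟩ else 0, ?_⟩
    rw [← hc₀, ← Finset.sum_coe_sort A]
    exact Finset.sum_congr rfl fun k _ => by simp
  have hu : ∀ j, (x i - V.starProjection (x i)) j = X j i - ∑ k ∈ A, c k * X j k := by
    intro j
    rw [← hc]
    simp [x]
  refine ⟨fun j => (x i - V.starProjection (x i)) j, c, ?_, ?_, hu⟩
  · intro h0
    apply hi
    have he : (fun j => X j i : Fin n → ℝ) = ∑ k ∈ A, c k • (fun j => X j k : Fin n → ℝ) := by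
      funext j
      have := congrFun h0 j
      simp only [hu] at this
      simp at this ⊢
      linarith
    rw [he]
    exact Submodule.sum_mem _ fun k hk =>
      Submodule.smul_mem _ _ (Submodule.subset_span ⟨k, hk, rfl⟩)
  · intro k hk
    have := (Submodule.mem_orthogonal _ _).mp hort (x k) (Submodule.subset_span ⟨k, hk, rfl⟩)
    simpa [PiLp.inner_apply, x] using this

lemma aux_null {n : ℕ} (u : Fin n → ℝ) (hu : u ≠ 0) (a : ℝ) :
    ∀ᵐ y ∂(volume : Measure (Fin n → ℝ)), ∑ j, u j * y j ≠ a := by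
  let f : (Fin n → ℝ) →ₗ[ℝ] ℝ := dotProductBilin ℝ ℝ u
  have hf : ∀ y, f y = ∑ j, u j * y j := fun y => rfl
  have huu : f u ≠ 0 := by
    rw [hf]
    intro h
    exact hu (dotProduct_self_eq_zero.mp h)
  let S : AffineSubspace ℝ (Fin n → ℝ) := (AffineSubspace.mk' a ⊥).comap f.toAffineMap
  have hS : ∀ y, y ∈ S ↔ f y = a := by
    intro y
    simp [S, AffineSubspace.mem_comap, AffineSubspace.mem_mk', sub_eq_zero]
  have hne : S ≠ ⊤ := by
    intro h
    have h0 : (0 : Fin n → ℝ) ∈ S := h ▸ AffineSubspace.mem_top ℝ _ _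
    have h1 : u ∈ S := h ▸ AffineSubspace.mem_top ℝ _ _
    rw [hS] at h0 h1
    rw [map_zero] at h0
    exact huu (h1.trans h0.symm)
  have := Measure.addHaar_affineSubspace (volume : Measure (Fin n → ℝ)) S hne
  rw [ae_iff]
  convert this using 2
  ext y
  simp [hS, hf]

lemma aux_ae {n p : ℕ} (X : Matrix (Fin n) (Fin p) ℝ) (lam : ℝ) (A : Finset (Fin p))
    (σ : Fin p → SignType) (i : Fin p)
    (hi : (fun j => X j i : Fin n → ℝ) ∉ Submodule.span ℝ
      ((fun i => (fun j => X j i : Fin n → ℝ)) '' (A : Set (Fin p)))) :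
    ∀ᵐ y ∂(volume : Measure (Fin n → ℝ)), ∀ b : Fin p → ℝ, (∀ k, k ∉ A → b k = 0) →
      (∀ k ∈ A, corr y X b k = lam * σ k) → corr y X b i ≠ lam * σ i := by
  obtain ⟨u, c, hu, horth, huc⟩ := aux_proj X A i hi
  filter_upwards [aux_null u hu (lam * σ i - ∑ k ∈ A, c k * (lam * σ k))] with y hy b hb hA hE
  apply hy
  have h1 : ∑ j, u j * X.mulVec b j = 0 := by
    simp only [mulVec, dotProduct, Finset.mul_sum]
    rw [Finset.sum_comm]
    refine Finset.sum_eq_zero fun k _ => ?_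
    by_cases hk : k ∈ A
    · have := horth k hk
      calc ∑ j, u j * (X j k * b k) = (∑ j, u j * X j k) * b k := by
            rw [Finset.sum_mul]; exact Finset.sum_congr rfl fun j _ => by ring
        _ = 0 := by rw [this, zero_mul]
    · simp [hb k hk]
  have h2 : ∑ j, u j * (y j - X.mulVec b j) = corr y X b i - ∑ k ∈ A, c k * corr y X b k := by
    simp only [corr, huc, Finset.mul_sum, sub_mul, Finset.sum_mul, Finset.sum_sub_distrib]
    congr 1
    rw [Finset.sum_comm]
    exact Finset.sum_congr rfl fun k _ => Finset.sum_congr rfl fun j _ => by ring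
  have h3 : ∑ j, u j * y j = ∑ j, u j * (y j - X.mulVec b j) := by
    simp only [mul_sub, Finset.sum_sub_distrib, h1, sub_zero]
  rw [h3, h2, hE, Finset.sum_congr rfl fun k hk => by rw [hA k hk]]

/-- For fixed X and λ > 0, for almost every y, the span of the
active columns is the same for every lasso solution. -/
theorem stmt18 {n p : ℕ} (X : Matrix (Fin n) (Fin p) ℝ) (lam : ℝ)
    (hlam : 0 < lam) :
    ∀ᵐ y ∂(volume : Measure (Fin n → ℝ)),
      ∀ b₁ b₂ : Fin p → ℝ, IsLassoSol y X lam b₁ → IsLassoSol y X lam b₂ →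
        Submodule.span ℝ ((fun i => (fun j => X j i : Fin n → ℝ)) ''
            {i : Fin p | b₁ i ≠ 0}) =
          Submodule.span ℝ ((fun i => (fun j => X j i : Fin n → ℝ)) ''
            {i : Fin p | b₂ i ≠ 0}) := by
  have hae := ae_all_iff.mpr fun A : Finset (Fin p) => ae_all_iff.mpr fun σ : Fin p → SignType =>
    ae_all_iff.mpr fun i : Fin p => eventually_imp_distrib_left.mpr (aux_ae X lam A σ i)
  filter_upwards [hae] with y hy
  have main : ∀ b₁ b₂ : Fin p → ℝ, IsLassoSol y X lam b₁ → IsLassoSol y X lam b₂ →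
        Submodule.span ℝ ((fun i => (fun j => X j i : Fin n → ℝ)) ''
            {i : Fin p | b₁ i ≠ 0}) ≤
          Submodule.span ℝ ((fun i => (fun j => X j i : Fin n → ℝ)) ''
            {i : Fin p | b₂ i ≠ 0}) := by
    intro b₁ b₂ h₁ h₂
    rw [Submodule.span_le]
    rintro _ ⟨i, hi, rfl⟩
    by_contra hn
    have hfit := aux_fit X lam hlam y b₁ b₂ h₁ h₂
    have hsg : ∀ k, |corr y X b₂ k| = lam →
        corr y X b₂ k = lam * (SignType.sign (corr y X b₂ k) : ℝ) := by
      intro k hk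
      nth_rw 1 [← sign_mul_abs (corr y X b₂ k), hk, mul_comm]
    have hc : corr y X b₁ i = corr y X b₂ i := by simp only [corr, hfit]
    classical
    refine hy (Finset.univ.filter fun k => b₂ k ≠ 0) (fun k => SignType.sign (corr y X b₂ k)) i
      (by simpa using hn) b₂ (by simp) ?_ ?_
    · intro k hk
      exact hsg k (aux_kkt X lam hlam y b₂ h₂ k (by simpa using hk))
    · exact hsg i (hc ▸ aux_kkt X lam hlam y b₁ h₁ i hi)
  intro b₁ b₂ h₁ h₂
  exact le_antisymm (main b₁ b₂ h₁ h₂) (main b₂ b₁ h₂ h₁)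
end
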